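/- Let n ≥ 1, let c be a nonnegative integer or half-integer, and let p be a nonnegative integer with p ≤ n such that (c^{n−p},(c−1)^p) is a partition or half-partition (i.e. c ≥ 1 if p ≥ 1). Then, as an identity of rational functions (in y_1,…,y_n with x_j = y_j^2 if c is a half-integer), so_{2n+1}((c^{n−p},(c−1)^p); x^{±1}) = (x_1 x_2 ⋯ x_n)^{−c} · Σ_{ν ⊆ ((2c)^n)} a_{n,p}(ν) · s_n(ν; x), where the sum ranges over all partitions ν with at most n parts, each part at most 2c, and a_{n,p}(ν) is the number of partitions ρ ⊆ ν such that ν/ρ is a vertical strip with exactly p cells, none of which lies in column 2c. -/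

import Mathlib

open scoped Classical
open Finset

noncomputable section

/-- Complete homogeneous symmetric polynomial of degree `m` in the variables `x`
(`0` for negative `m`). -/
def hpoly {R : Type} [CommRing R] {N : ℕ} (x : Fin N → R) (m : ℤ) : R :=
  if 0 ≤ m then
    ∑ f ∈ Finset.univ.filter (fun f : Fin m.toNat → Fin N => Monotone f), ∏ i, x (f i)
  else 0

/-- The Schur function `s(λ; x) = det(h_{λ_i-i+j})` (indices `1 ≤ i,j ≤ r`). -/
def schur {R : Type} [CommRing R] {N r : ℕ} (lam : Fin r → ℤ) (x : Fin N → R) : R :=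
  Matrix.det (Matrix.of fun i j : Fin r =>
    hpoly x (lam i - ((i : ℕ) : ℤ) + ((j : ℕ) : ℤ)))

/-- The field of rational functions in `n` variables over `ℚ`. -/
abbrev FF (n : ℕ) : Type := FractionRing (MvPolynomial (Fin n) ℚ)

/-- The variables, as elements of the rational function field. -/
def Xv (n : ℕ) : Fin n → FF n := fun i =>
  algebraMap (MvPolynomial (Fin n) ℚ) (FF n) (MvPolynomial.X i)

/-- Irreducible odd orthogonal character `so_{2n+1}(λ; x^{±1})`, written in the
variables `y` where `x_j = y_j²`; here `L` is the doubled index, `L = 2λ`. -/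
def soOdd {F : Type} [Field F] (n : ℕ) (L : Fin n → ℤ) (y : Fin n → F) : F :=
  Matrix.det (Matrix.of fun i j : Fin n =>
    y j ^ (L i + 2 * (n : ℤ) - 2 * ((i : ℕ) : ℤ) - 1) -
      y j ^ (-(L i + 2 * (n : ℤ) - 2 * ((i : ℕ) : ℤ) - 1))) /
  Matrix.det (Matrix.of fun i j : Fin n =>
    y j ^ (2 * (n : ℤ) - 2 * ((i : ℕ) : ℤ) - 1) -
      y j ^ (-(2 * (n : ℤ) - 2 * ((i : ℕ) : ℤ) - 1)))


/-- `a_{n,p}(ν)`: the number of partitions `ρ ⊆ ν` such that `ν/ρ` is a vertical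
strip with exactly `p` cells, none of which lies in column `2c = C`. -/
def aCoeff (n C p : ℕ) (ν : Fin n → ℕ) : ℕ :=
  ((Fintype.piFinset fun _ : Fin n => Finset.range (C + 1)).filter
    (fun ρ => Antitone ρ ∧ (∀ i, ρ i ≤ ν i) ∧ (∀ i, ν i ≤ ρ i + 1) ∧
      (Finset.univ.filter (fun i : Fin n => ρ i < ν i)).card = p ∧
      (∀ i, ρ i < ν i → ν i ≠ C))).card

/-! ### Lagrange-type identities -/

theorem lagr_zero {F : Type} [Field F] (s : Finset F) (p : Polynomial F)
    (hp : p.natDegree + 1 < s.card) :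
    ∑ a ∈ s, p.eval a / ∏ b ∈ s.erase a, (a - b) = 0 := by
  have h := Lagrange.coeff_eq_sum (s := s) (v := id) (Function.injective_id.injOn) (P := p)
    (lt_of_le_of_lt Polynomial.degree_le_natDegree (by exact_mod_cast (by omega)))
  simp only [id] at h
  rw [← h]
  apply Polynomial.coeff_eq_zero_of_natDegree_lt
  omega

/-- Three extra nodes. -/
theorem key_aux {F : Type} [Field F] (W : Finset F) (t : F) (ht0 : t ≠ 0) (ht1 : t ≠ 1)
    (h0 : (0 : F) ∉ W) (h1 : (-1 : F) ∉ W) (h2 : -t⁻¹ ∉ W) :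
    ∑ a ∈ W, (1 - a) * (∏ b ∈ W.erase a, (1 - b * a) / (b - a)) / (a * (1 + t * a))
      = (∏ a ∈ W, a)⁻¹ - 1 / (1 - t)
        + t / (1 - t) * ((∏ a ∈ W, (t + a)) / ∏ a ∈ W, (1 + t * a)) := by
  have h1t : (1 - t) ≠ 0 := sub_ne_zero.mpr (Ne.symm ht1)
  have hti : -t⁻¹ ≠ 0 := neg_ne_zero.mpr (inv_ne_zero ht0)
  have hm1 : (-1 : F) ≠ 0 := by simp
  have hmt : (-1 : F) ≠ -t⁻¹ := by
    intro h; apply ht1; have := neg_injective h; exact (inv_eq_one.mp this.symm)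
  have n2 : -1 ∉ insert (-t⁻¹) W := by simp [h1]; exact ht1
  have n3 : (0:F) ∉ insert (-1) (insert (-t⁻¹) W) := by simp [h0, ht0]
  let p : Polynomial F := ∏ a ∈ W, (1 - Polynomial.C a * Polynomial.X)
  have hpe : ∀ z, p.eval z = ∏ a ∈ W, (1 - a * z) := by
    intro z; simp [p, Polynomial.eval_prod]
  have hpd : p.natDegree ≤ W.card := by
    refine (Polynomial.natDegree_prod_le _ _).trans ?_
    rw [Finset.card_eq_sum_ones]
    refine Finset.sum_le_sum fun a _ => ?_
    compute_degree
  have H := lagr_zero (insert 0 (insert (-1) (insert (-t⁻¹) W))) p (by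
    rw [Finset.card_insert_of_notMem n3, Finset.card_insert_of_notMem n2,
      Finset.card_insert_of_notMem h2]; omega)
  have hW0 : ∀ a ∈ W, a ≠ 0 := fun a ha h => h0 (h ▸ ha)
  have hW1 : ∀ a ∈ W, 1 + a ≠ 0 := fun a ha h => h1 (by
    have : a = -1 := by linear_combination h
    exact this ▸ ha)
  have hW2 : ∀ a ∈ W, 1 + t * a ≠ 0 := fun a ha h => h2 (by
    have : a = -t⁻¹ := by field_simp; linear_combination h
    exact this ▸ ha)
  rw [Finset.sum_insert n3, Finset.sum_insert n2, Finset.sum_insert h2,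
    Finset.erase_insert n3] at H
  have e1 : (insert (0:F) (insert (-1) (insert (-t⁻¹) W))).erase (-1)
      = insert 0 (insert (-t⁻¹) W) := by
    rw [Finset.erase_insert_of_ne (Ne.symm hm1), Finset.erase_insert n2]
  have e2 : (insert (0:F) (insert (-1) (insert (-t⁻¹) W))).erase (-t⁻¹)
      = insert 0 (insert (-1) W) := by
    rw [Finset.erase_insert_of_ne (Ne.symm hti), Finset.erase_insert_of_ne hmt,
      Finset.erase_insert h2]
  have n4 : (0:F) ∉ insert (-t⁻¹) W := by simp [h0, ht0]
  have n5 : (0:F) ∉ insert (-1) W := by simp [h0]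
  rw [e1, e2, Finset.prod_insert n2, Finset.prod_insert h2, Finset.prod_insert n4,
    Finset.prod_insert h2, Finset.prod_insert n5, Finset.prod_insert h1] at H
  have e3 : ∑ a ∈ W, p.eval a / ∏ b ∈ (insert (0:F) (insert (-1) (insert (-t⁻¹) W))).erase a, (a - b)
      = ∑ a ∈ W, t * (-1)^(W.card - 1) *
        ((1 - a) * (∏ b ∈ W.erase a, (1 - b * a) / (b - a)) / (a * (1 + t * a))) := by
    refine Finset.sum_congr rfl fun a ha => ?_
    have ha0 := hW0 a ha
    have ha1 := hW1 a ha
    have ha2 := hW2 a ha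
    have q1 : (0:F) ≠ a := Ne.symm ha0
    have q2 : (-1:F) ≠ a := fun h => h1 (h ▸ ha)
    have q3 : -t⁻¹ ≠ a := fun h => h2 (h ▸ ha)
    rw [Finset.erase_insert_of_ne q1, Finset.erase_insert_of_ne q2, Finset.erase_insert_of_ne q3]
    rw [Finset.prod_insert (by simp [h0, ht0]), Finset.prod_insert (by
      simp [h1]; exact ht1),
      Finset.prod_insert (by simp [h2]), hpe, ← Finset.mul_prod_erase W _ ha]
    have e5 : ∏ b ∈ W.erase a, (a - b) = (-1)^(W.card - 1) * ∏ b ∈ W.erase a, (b - a) := by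
      rw [← Finset.card_erase_of_mem ha, ← Finset.prod_const, ← Finset.prod_mul_distrib]
      exact Finset.prod_congr rfl fun b _ => by ring
    have e6 : (a - 0) * ((a - -1) * ((a - -t⁻¹) * ∏ b ∈ W.erase a, (a - b)))
        = (a * (1 + a) * (1 + t * a) / t) * ∏ b ∈ W.erase a, (a - b) := by
      field_simp; ring
    rw [e6, e5, Finset.prod_div_distrib]
    have hne : ∏ b ∈ W.erase a, (b - a) ≠ 0 := Finset.prod_ne_zero_iff.mpr fun b hb =>
      sub_ne_zero.mpr (Finset.ne_of_mem_erase hb)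
    have hs : ((-1:F)^(W.card - 1)) * (-1)^(W.card - 1) = 1 := by
      rw [← mul_pow]; simp
    have hs0 : ((-1:F)^(W.card - 1)) ≠ 0 := pow_ne_zero _ (by simp)
    field_simp
    have hs2 : (((-1:F)^(W.card - 1)))^2 = 1 := by rw [sq]; exact hs
    rw [hs2]; ring
  rw [e3, ← Finset.mul_sum] at H
  simp only [hpe] at H
  rcases W.eq_empty_or_nonempty with rfl | hne
  · simp; field_simp; ring
  have hc : 1 ≤ W.card := Finset.card_pos.mpr hne
  obtain ⟨m, hm⟩ : ∃ m, W.card = m + 1 := ⟨W.card - 1, by omega⟩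
  have z1 : ∏ a ∈ W, (1 - a * 0) = 1 := by simp
  have z2 : ∏ b ∈ W, (0 - b) = (-1)^(m+1) * ∏ b ∈ W, b := by
    rw [← hm, ← Finset.prod_const, ← Finset.prod_mul_distrib]
    exact Finset.prod_congr rfl fun b _ => by ring
  have z3 : ∏ a ∈ W, (1 - a * -1) = ∏ a ∈ W, (1 + a) :=
    Finset.prod_congr rfl fun b _ => by ring
  have z4 : ∏ a ∈ W, (-1 - a) = (-1)^(m+1) * ∏ a ∈ W, (1 + a) := by
    rw [← hm, ← Finset.prod_const, ← Finset.prod_mul_distrib]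
    exact Finset.prod_congr rfl fun b _ => by ring
  have z5 : ∏ a ∈ W, (1 - a * -t⁻¹) = (t⁻¹)^(m+1) * ∏ a ∈ W, (t + a) := by
    rw [← hm, ← Finset.prod_const, ← Finset.prod_mul_distrib]
    exact Finset.prod_congr rfl fun b _ => by field_simp; ring
  have z6 : ∏ a ∈ W, (-t⁻¹ - a) = (-t⁻¹)^(m+1) * ∏ a ∈ W, (1 + t * a) := by
    rw [← hm, ← Finset.prod_const, ← Finset.prod_mul_distrib]
    exact Finset.prod_congr rfl fun b _ => by field_simp; ring
  rw [z1, z2, z3, z4, z5, z6, hm, neg_pow t⁻¹] at H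
  have hP0 : ∏ a ∈ W, a ≠ 0 := Finset.prod_ne_zero_iff.mpr hW0
  have hP1 : ∏ a ∈ W, (1 + a) ≠ 0 := Finset.prod_ne_zero_iff.mpr hW1
  have hP2 : ∏ a ∈ W, (1 + t * a) ≠ 0 := Finset.prod_ne_zero_iff.mpr hW2
  generalize ∑ a ∈ W, (1 - a) * (∏ b ∈ W.erase a, (1 - b * a) / (b - a)) / (a * (1 + t * a)) = S at *
  generalize ∏ a ∈ W, a = P0 at *
  generalize ∏ a ∈ W, (1 + a) = P1 at *
  generalize ∏ a ∈ W, (1 + t * a) = P2 at *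
  generalize ∏ a ∈ W, (t + a) = P3 at *
  have hs0 : ((-1:F)^m) ≠ 0 := pow_ne_zero _ (by simp)
  have hs2 : ((-1:F)^m)^2 = 1 := by rw [← pow_mul, mul_comm, pow_mul]; simp
  simp only [pow_succ, Nat.add_sub_cancel] at H
  have htm : (t⁻¹)^m ≠ 0 := pow_ne_zero _ (inv_ne_zero ht0)
  generalize (t⁻¹)^m = T at *
  have hd1 : (-1 - -t⁻¹) = (1 - t)/t := by field_simp; ring
  have hd2 : (-t⁻¹ - -1) = -(1 - t)/t := by field_simp; ring
  rw [hd1, hd2] at H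
  have hI : ((-1:F)^m)⁻¹ = (-1)^m := by
    rw [inv_eq_iff_eq_inv, eq_comm]; exact inv_eq_of_mul_eq_one_left (by rw [← sq]; exact hs2)
  generalize (-1:F)^m = e at *
  have H2 : t * e * (S - (P0⁻¹ - 1 / (1 - t) + t / (1 - t) * (P3 / P2))) = 0 := by
    rw [← H]
    have : e⁻¹ = e := hI
    field_simp
    rw [hs2]
    ring
  have := (mul_eq_zero.mp H2).resolve_left (mul_ne_zero ht0 hs0)
  linear_combination this

theorem key1 {F : Type} [Field F] (W : Finset F) (t : F) (ht0 : t ≠ 0) (ht1 : t ≠ 1)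
    (h0 : (0 : F) ∉ W) (h1 : (-1 : F) ∉ W) (h2 : -t⁻¹ ∉ W) :
    ∏ a ∈ W, (1 + t * a) = (∏ a ∈ W, a) *
        ((∏ a ∈ W, (1 + t * a) - t * ∏ a ∈ W, (t + a)) / (1 - t)) +
      ∑ a ∈ W, (1 - a) * ∏ b ∈ W.erase a, (b * (1 - b * a) / (b - a) * (1 + t * b)) := by
  have h1t : (1 - t) ≠ 0 := sub_ne_zero.mpr (Ne.symm ht1)
  have hW0 : ∀ a ∈ W, a ≠ 0 := fun a ha h => h0 (h ▸ ha)
  have hW2 : ∀ a ∈ W, 1 + t * a ≠ 0 := fun a ha h => h2 (by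
    have : a = -t⁻¹ := by field_simp; linear_combination h
    exact this ▸ ha)
  have K := key_aux W t ht0 ht1 h0 h1 h2
  have hP0 : ∏ a ∈ W, a ≠ 0 := Finset.prod_ne_zero_iff.mpr hW0
  have hP2 : ∏ a ∈ W, (1 + t * a) ≠ 0 := Finset.prod_ne_zero_iff.mpr hW2
  have e : ∑ a ∈ W, (1 - a) * ∏ b ∈ W.erase a, (b * (1 - b * a) / (b - a) * (1 + t * b))
     = ((∏ a ∈ W, a) * ∏ a ∈ W, (1 + t * a)) *
      ∑ a ∈ W, (1 - a) * (∏ b ∈ W.erase a, (1 - b * a) / (b - a)) / (a * (1 + t * a)) := by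
    rw [Finset.mul_sum]
    refine Finset.sum_congr rfl fun a ha => ?_
    have ha0 := hW0 a ha
    have ha2 := hW2 a ha
    rw [← Finset.mul_prod_erase W (fun a => a) ha, ← Finset.mul_prod_erase W (fun a => 1 + t * a) ha]
    have : ∏ b ∈ W.erase a, (b * (1 - b * a) / (b - a) * (1 + t * b))
      = (∏ b ∈ W.erase a, b) * (∏ b ∈ W.erase a, (1 - b * a) / (b - a)) *
        ∏ b ∈ W.erase a, (1 + t * b) := by
      rw [← Finset.prod_mul_distrib, ← Finset.prod_mul_distrib]
      exact Finset.prod_congr rfl fun b _ => by ring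
    rw [this]
    have ha3 : 1 + a * t ≠ 0 := by rwa [mul_comm a t]
    field_simp
  rw [e, K]
  field_simp
  ring

theorem key2 {F : Type} [Field F] (W : Finset F) (t : F) (ht0 : t ≠ 0) (ht1 : t ≠ 1)
    (h0 : (0 : F) ∉ W) (h1 : (-1 : F) ∉ W) (h2 : -t ∉ W) :
    ∏ a ∈ W, (t + a) = (∏ a ∈ W, a) *
        ((∏ a ∈ W, (1 + t * a) - t * ∏ a ∈ W, (t + a)) / (1 - t)) +
      t * ∑ a ∈ W, (1 - a) * ∏ b ∈ W.erase a, (b * (1 - b * a) / (b - a) * (t + b)) := by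
  have h1t : (1 - t) ≠ 0 := sub_ne_zero.mpr (Ne.symm ht1)
  have K := key1 W t⁻¹ (inv_ne_zero ht0) (by simpa using ht1) h0 h1 (by simpa using h2)
  have a1 : ∏ a ∈ W, (1 + t⁻¹ * a) = (t⁻¹)^W.card * ∏ a ∈ W, (t + a) := by
    rw [← Finset.prod_const, ← Finset.prod_mul_distrib]
    exact Finset.prod_congr rfl fun b _ => by field_simp
  have a2 : ∏ a ∈ W, (t⁻¹ + a) = (t⁻¹)^W.card * ∏ a ∈ W, (1 + t * a) := by
    rw [← Finset.prod_const, ← Finset.prod_mul_distrib]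
    exact Finset.prod_congr rfl fun b _ => by field_simp
  have a3 : ∑ a ∈ W, (1 - a) * ∏ b ∈ W.erase a, (b * (1 - b * a) / (b - a) * (1 + t⁻¹ * b))
     = (t⁻¹)^W.card * (t * ∑ a ∈ W, (1 - a) * ∏ b ∈ W.erase a, (b * (1 - b * a) / (b - a) * (t + b))) := by
    rw [Finset.mul_sum, Finset.mul_sum]
    refine Finset.sum_congr rfl fun a ha => ?_
    have : ∏ b ∈ W.erase a, (b * (1 - b * a) / (b - a) * (1 + t⁻¹ * b))
      = t⁻¹ ^ (W.card - 1) * ∏ b ∈ W.erase a, (b * (1 - b * a) / (b - a) * (t + b)) := by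
      rw [← Finset.card_erase_of_mem ha, ← Finset.prod_const, ← Finset.prod_mul_distrib]
      exact Finset.prod_congr rfl fun b _ => by
        have : 1 + t⁻¹ * b = t⁻¹ * (t + b) := by field_simp
        rw [this]; ring
    rw [this]
    obtain ⟨m, hm⟩ : ∃ m, W.card = m + 1 := ⟨W.card - 1, by have := Finset.card_pos.mpr ⟨a, ha⟩; omega⟩
    rw [hm, Nat.add_sub_cancel, pow_succ]
    field_simp
  rw [a1, a2, a3] at K
  have hT : (t⁻¹)^W.card ≠ 0 := pow_ne_zero _ (inv_ne_zero ht0)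
  generalize (t⁻¹)^W.card = T at *
  generalize ∑ a ∈ W, (1 - a) * ∏ b ∈ W.erase a, (b * (1 - b * a) / (b - a) * (t + b)) = S at *
  generalize ∏ a ∈ W, a = P0 at *
  generalize ∏ a ∈ W, (1 + t * a) = P2 at *
  generalize ∏ a ∈ W, (t + a) = P3 at *
  have h1t' : (1 - t⁻¹) = -(1 - t) / t := by field_simp; ring
  rw [h1t'] at K
  apply mul_left_cancel₀ hT
  rw [K]
  field_simp
  ring


/-! ### Pair products and the symmetric-function side -/

/-- Product over pairs `i < j`. -/
def pp {F : Type} [Field F] {n : ℕ} (f : Fin n → Fin n → F) : F :=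
  ∏ a, ∏ b, if a < b then f a b else 1

theorem pp_succAbove {F : Type} [Field F] {n : ℕ} (f : Fin (n+1) → Fin (n+1) → F)
    (j : Fin (n+1)) :
    pp f = (∏ i : Fin n, if j < j.succAbove i then f j (j.succAbove i) else f (j.succAbove i) j) *
      pp (fun a b => f (j.succAbove a) (j.succAbove b)) := by
  unfold pp
  rw [Fin.prod_univ_succAbove _ j]
  rw [Fin.prod_univ_succAbove _ j]
  simp only [lt_self_iff_false, if_false, one_mul]
  have : ∀ i : Fin n, (∏ b, if j.succAbove i < b then f (j.succAbove i) b else 1)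
      = (if j.succAbove i < j then f (j.succAbove i) j else 1) *
        ∏ b, if i < b then f (j.succAbove i) (j.succAbove b) else 1 := by
    intro i
    rw [Fin.prod_univ_succAbove _ j]
    simp only [Fin.succAbove_lt_succAbove_iff]
  simp only [this]
  rw [Finset.prod_mul_distrib, ← mul_assoc, ← Finset.prod_mul_distrib]
  congr 1
  refine Finset.prod_congr rfl fun i _ => ?_
  have hne := Fin.succAbove_ne j i
  rcases lt_or_gt_of_ne hne with h | h
  · simp [h, not_lt.mpr h.le]
  · simp [h, not_lt.mpr h.le]

theorem pp_mul {F : Type} [Field F] {n : ℕ} (f g : Fin n → Fin n → F) :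
    pp (fun a b => f a b * g a b) = pp f * pp g := by
  unfold pp
  simp only [← Finset.prod_mul_distrib]
  refine Finset.prod_congr rfl fun a _ => Finset.prod_congr rfl fun b _ => ?_
  split_ifs <;> simp

theorem pp_inv {F : Type} [Field F] {n : ℕ} (f : Fin n → Fin n → F) :
    pp (fun a b => (f a b)⁻¹) = (pp f)⁻¹ := by
  unfold pp
  simp only [← Finset.prod_inv_distrib]
  refine Finset.prod_congr rfl fun a _ => Finset.prod_congr rfl fun b _ => ?_
  split_ifs <;> simp

theorem pp_congr {F : Type} [Field F] {n : ℕ} {f g : Fin n → Fin n → F}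
    (h : ∀ a b, a < b → f a b = g a b) : pp f = pp g := by
  unfold pp
  refine Finset.prod_congr rfl fun a _ => Finset.prod_congr rfl fun b _ => ?_
  split_ifs with hh
  · exact h a b hh
  · rfl

theorem pp_ne_zero {F : Type} [Field F] {n : ℕ} {f : Fin n → Fin n → F}
    (h : ∀ a b, a < b → f a b ≠ 0) : pp f ≠ 0 := by
  unfold pp
  refine Finset.prod_ne_zero_iff.mpr fun a _ => Finset.prod_ne_zero_iff.mpr fun b _ => ?_
  split_ifs with hh
  · exact h a b hh
  · exact one_ne_zero

theorem pp_pow {F : Type} [Field F] {n : ℕ} (a : Fin n → F) :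
    pp (fun i j => a i * a j) = ∏ j, a j ^ (n - 1) := by
  induction n with
  | zero => simp [pp]
  | succ n ih =>
    rw [pp_succAbove _ 0]
    simp only [Fin.succAbove_zero, Fin.succ_pos, if_true]
    rw [ih (fun i => a i.succ), Finset.prod_mul_distrib, Fin.prod_univ_succ]
    simp only [Finset.prod_const, Finset.card_univ, Fintype.card_fin, Nat.add_sub_cancel]
    rw [mul_assoc, ← Finset.prod_mul_distrib]
    congr 1
    refine Finset.prod_congr rfl fun i _ => ?_
    cases n with
    | zero => exact i.elim0
    | succ m => rw [Nat.add_sub_cancel, pow_succ]; ring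

theorem pp_eq_Ioi {F : Type} [Field F] {n : ℕ} (f : Fin n → Fin n → F) :
    pp f = ∏ i, ∏ j ∈ Finset.Ioi i, f i j := by
  unfold pp
  refine Finset.prod_congr rfl fun a _ => ?_
  rw [← Finset.prod_filter]
  refine Finset.prod_congr ?_ fun _ _ => rfl
  ext; simp

/-- Genericity conditions. -/
structure Good {F : Type} [Field F] {n : ℕ} (t : F) (x : Fin n → F) : Prop where
  t0 : t ≠ 0
  t1 : t ≠ 1
  x0 : ∀ j, x j ≠ 0
  x1 : ∀ j, x j ≠ 1
  xm : ∀ j, x j ≠ -1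
  inj : Function.Injective x
  mul : ∀ i j, i ≠ j → x i * x j ≠ 1
  tx : ∀ j, t ≠ - x j
  ti : ∀ j, t ≠ - (x j)⁻¹

theorem Good.sa {F : Type} [Field F] {n : ℕ} {t : F} {x : Fin (n+1) → F} (h : Good t x)
    (j : Fin (n+1)) : Good t (fun i => x (j.succAbove i)) where
  t0 := h.t0
  t1 := h.t1
  x0 _ := h.x0 _
  x1 _ := h.x1 _
  xm _ := h.xm _
  inj := h.inj.comp Fin.succAbove_right_injective
  mul _ _ hab := h.mul _ _ (fun h => hab (Fin.succAbove_right_injective h))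
  tx _ := h.tx _
  ti _ := h.ti _

/-- Sign-twisted variables. -/
def ww {F : Type} [Field F] {n : ℕ} (x : Fin n → F) (ε : Fin n → Bool) (j : Fin n) : F :=
  if ε j then (x j)⁻¹ else x j

/-- Inverse Weyl factor. -/
def gg {F : Type} [Field F] {n : ℕ} (w : Fin n → F) : F :=
  (∏ j, (1 - w j))⁻¹ * (pp fun i j => 1 - w i * w j)⁻¹

/-- Coefficient of the `S` form. -/
def cS {F : Type} [Field F] {n : ℕ} (t : F) (x : Fin n → F) (ε : Fin n → Bool) : F :=
  ∏ j, if ε j then 1 + t * (x j)⁻¹ else 1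

/-- Coefficient of the `X` form. -/
def cX {F : Type} [Field F] {n : ℕ} (t : F) (x : Fin n → F) (ε : Fin n → Bool) : F :=
  ∏ j, if ε j then t + (x j)⁻¹ else 1

/-- Coefficient of the `R` form. -/
def cR {F : Type} [Field F] {n : ℕ} (t : F) (x : Fin n → F) (ε : Fin n → Bool) : F :=
  (cS t x ε - t * cX t x ε) / (1 - t)

/-- Common factor. -/
def tm {F : Type} [Field F] {n : ℕ} (C : ℤ) (t : F) (x : Fin n → F) (ε : Fin n → Bool) : F :=
  (∏ j, if ε j then x j ^ C else 1 + t * x j) * gg (ww x ε)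

/-- The `S` form. -/
def Sf {F : Type} [Field F] {n : ℕ} (C : ℤ) (t : F) (x : Fin n → F) : F :=
  ∑ ε, tm C t x ε * cS t x ε

/-- The `X` form. -/
def Xf {F : Type} [Field F] {n : ℕ} (C : ℤ) (t : F) (x : Fin n → F) : F :=
  ∑ ε, tm C t x ε * cX t x ε

/-- The `R` form. -/
def Rf {F : Type} [Field F] {n : ℕ} (C : ℤ) (t : F) (x : Fin n → F) : F :=
  ∑ ε, tm C t x ε * cR t x ε

/-- Row-removal operator. -/
def PP {F : Type} [Field F] {n : ℕ} (e : ℤ) (x : Fin (n+1) → F) (f : Fin (n+1) → F) : F :=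
  ∑ j, x j ^ (e + n) / (∏ i, (x j - x (j.succAbove i))) * f j

/-- Local interaction factor. -/
def ph {F : Type} [Field F] (a b : F) : F := b * (1 - b * a) / (b - a)

theorem tm_split {F : Type} [Field F] {n : ℕ} (C : ℤ) (t : F) (x : Fin (n+1) → F)
    (j : Fin (n+1)) (ε : Fin n → Bool) :
    tm C t x (j.insertNth true ε) = tm C t (fun i => x (j.succAbove i)) ε *
      (x j ^ C * (1 - (x j)⁻¹)⁻¹ *
        ∏ i, (1 - ww (fun i => x (j.succAbove i)) ε i * (x j)⁻¹)⁻¹) := by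
  have hw0 : ww x (j.insertNth true ε) j = (x j)⁻¹ := by simp [ww]
  have hw : ∀ i, ww x (j.insertNth true ε) (j.succAbove i) = ww (fun i => x (j.succAbove i)) ε i := by
    intro i; simp [ww]
  unfold tm gg
  rw [pp_succAbove _ j, Fin.prod_univ_succAbove _ j, Fin.prod_univ_succAbove _ j]
  simp only [hw0, hw, Fin.insertNth_apply_same, Fin.insertNth_apply_succAbove, if_true]
  have : ∀ i, (if j < j.succAbove i then 1 - (x j)⁻¹ * ww (fun i => x (j.succAbove i)) ε i
      else 1 - ww (fun i => x (j.succAbove i)) ε i * (x j)⁻¹)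
      = 1 - ww (fun i => x (j.succAbove i)) ε i * (x j)⁻¹ := by
    intro i; split_ifs <;> ring
  simp only [this, mul_inv, Finset.prod_inv_distrib]
  ring

theorem tm_rec {F : Type} [Field F] {n : ℕ} (C : ℤ) (t : F) (x : Fin (n+1) → F) (hx : Good t x)
    (c : Fin (n+1) → (Fin n → Bool) → F) :
    PP C x (fun j => ∑ ε, tm C t (fun i => x (j.succAbove i)) ε * c j ε) =
      ∑ ε, tm C t x ε * ∑ j, if ε j then (1 - (x j)⁻¹) *
        (∏ i, if ε (j.succAbove i) then ph (x j)⁻¹ (x (j.succAbove i))⁻¹ else 1) *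
          c j (fun i => ε (j.succAbove i)) else 0 := by
  unfold PP
  simp only [Finset.mul_sum]
  rw [Finset.sum_comm (s := (Finset.univ : Finset (Fin (n+1) → Bool)))]
  refine Finset.sum_congr rfl fun j _ => ?_
  rw [← (Fin.insertNthEquiv (fun _ => Bool) j).sum_comp, Fintype.sum_prod_type]
  simp only [Fin.insertNthEquiv_apply, Fintype.sum_bool, Fin.insertNth_apply_same, if_true,
    Fin.insertNth_apply_succAbove]
  simp only [Bool.false_eq_true, if_false, mul_zero, Finset.sum_const_zero, add_zero]
  refine Finset.sum_congr rfl fun ε _ => ?_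
  have hE : (Fin.insertNthEquiv (fun _ => Bool) j) (true, ε) = j.insertNth true ε := rfl
  rw [hE, tm_split]
  have hj0 := hx.x0 j
  have key : x j ^ (C + n) / (∏ i, (x j - x (j.succAbove i))) =
      x j ^ C * (∏ i, (1 - ww (fun i => x (j.succAbove i)) ε i * (x j)⁻¹)⁻¹) *
        ∏ i, if ε i then ph (x j)⁻¹ (x (j.succAbove i))⁻¹ else 1 := by
    rw [zpow_add₀ hj0, mul_assoc, ← Finset.prod_mul_distrib, mul_div_assoc]
    congr 1
    have : x j ^ (n : ℤ) = ∏ _i : Fin n, x j := by simp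
    rw [this, ← Finset.prod_div_distrib]
    refine Finset.prod_congr rfl fun i _ => ?_
    have hne : x j - x (j.succAbove i) ≠ 0 := sub_ne_zero.mpr fun h =>
      Fin.succAbove_ne j i (hx.inj h).symm
    have hm : x j * x (j.succAbove i) - 1 ≠ 0 := sub_ne_zero.mpr
      (hx.mul _ _ (Fin.succAbove_ne j i).symm)
    have hi0 := hx.x0 (j.succAbove i)
    unfold ww ph
    cases ε i with
    | true =>
      simp only [if_true]
      have e1 : 1 - (x (j.succAbove i))⁻¹ * (x j)⁻¹ =
        (x j * x (j.succAbove i) - 1) / (x j * x (j.succAbove i)) := by field_simp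
      have e2 : (x (j.succAbove i))⁻¹ - (x j)⁻¹ =
        (x j - x (j.succAbove i)) / (x j * x (j.succAbove i)) := by field_simp
      rw [e1, e2]; field_simp
    | false =>
      simp only [Bool.false_eq_true, if_false, mul_one]
      have e1 : 1 - (x (j.succAbove i)) * (x j)⁻¹ =
        (x j - x (j.succAbove i)) / (x j) := by field_simp
      rw [e1]; field_simp
  rw [key]
  have h1 : 1 - (x j)⁻¹ ≠ 0 := by
    rw [sub_ne_zero]; intro h; exact hx.x1 j (inv_eq_one.mp h.symm)
  have hu := inv_mul_cancel₀ h1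
  generalize (1 - (x j)⁻¹)⁻¹ = u at *
  generalize (1 - (x j)⁻¹) = v at *
  generalize (∏ i, (1 - ww (fun i => x (j.succAbove i)) ε i * (x j)⁻¹)⁻¹) = A at *
  generalize (∏ i, if ε i = true then ph (x j)⁻¹ (x (j.succAbove i))⁻¹ else 1) = B at *
  linear_combination (-(x j ^ C * A * B * tm C t (fun i => x (j.succAbove i)) ε * c j ε)) * hu

theorem key_transfer {F : Type} [Field F] {n : ℕ} (t : F) (x : Fin (n+1) → F) (hx : Good t x)
    (ε : Fin (n+1) → Bool) (φ : F → F) :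
    ∃ W : Finset F, (0 ∉ W ∧ -1 ∉ W ∧ -t⁻¹ ∉ W ∧ -t ∉ W) ∧
      (∀ ψ : F → F, ∏ a ∈ W, ψ a = ∏ j, if ε j then ψ (x j)⁻¹ else 1) ∧
      ∑ a ∈ W, (1 - a) * ∏ b ∈ W.erase a, (b * (1 - b * a) / (b - a) * φ b)
       = ∑ j, if ε j then (1 - (x j)⁻¹) *
        (∏ i, if ε (j.succAbove i) then ph (x j)⁻¹ (x (j.succAbove i))⁻¹ else 1) *
          (∏ i, if ε (j.succAbove i) then φ (x (j.succAbove i))⁻¹ else 1) else 0 := by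
  have hinj : Function.Injective (fun j => (x j)⁻¹) := fun a b h => hx.inj (inv_injective h)
  let emb : Fin (n+1) ↪ F := ⟨fun j => (x j)⁻¹, hinj⟩
  refine ⟨(Finset.univ.filter (fun j => ε j = true)).map emb, ⟨?_, ?_, ?_, ?_⟩, ?_, ?_⟩
  · simp [emb, hx.x0]
  · simp only [emb, Finset.mem_map, Finset.mem_filter, Function.Embedding.coeFn_mk, not_exists, not_and]
    intro j _ h
    exact hx.xm j (by rw [← inv_inv (x j), h]; simp)
  · simp only [emb, Finset.mem_map, Finset.mem_filter, Function.Embedding.coeFn_mk, not_exists, not_and]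
    intro j _ h
    apply hx.tx j
    rw [← inv_inv (x j), h]; simp
  · simp only [emb, Finset.mem_map, Finset.mem_filter, Function.Embedding.coeFn_mk, not_exists, not_and]
    intro j _ h
    apply hx.ti j
    rw [h]; simp
  · intro ψ
    rw [Finset.prod_map, Finset.prod_filter]
    rfl
  · rw [Finset.sum_map, Finset.sum_filter]
    refine Finset.sum_congr rfl fun j _ => ?_
    by_cases hj : ε j = true
    · simp only [hj, if_true]
      rw [← Finset.map_erase, Finset.prod_map, mul_assoc, ← Finset.prod_mul_distrib]
      congr 1
      have : (Finset.univ.filter (fun j => ε j = true)).erase j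
        = Finset.univ.filter (fun i => i ≠ j ∧ ε i = true) := by
        ext; simp
      rw [this, Finset.prod_filter, Fin.prod_univ_succAbove _ j]
      simp only [ne_eq, not_true_eq_false, false_and, if_false, one_mul, Fin.succAbove_ne,
        not_false_eq_true, true_and]
      refine Finset.prod_congr rfl fun i _ => ?_
      split_ifs <;> simp [emb, ph]
    · simp [hj]

theorem cS_rec {F : Type} [Field F] {n : ℕ} (t : F) (x : Fin (n+1) → F) (hx : Good t x)
    (ε : Fin (n+1) → Bool) :
    cS t x ε = (∏ j, if ε j then (x j)⁻¹ else 1) * cR t x ε +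
      ∑ j, if ε j then (1 - (x j)⁻¹) *
        (∏ i, if ε (j.succAbove i) then ph (x j)⁻¹ (x (j.succAbove i))⁻¹ else 1) *
          cS t (fun i => x (j.succAbove i)) (fun i => ε (j.succAbove i)) else 0 := by
  obtain ⟨W, ⟨h0, h1, h2, h3⟩, hp, hs⟩ := key_transfer t x hx ε (fun b => 1 + t * b)
  have := key1 W t hx.t0 hx.t1 h0 h1 h2
  rw [hs] at this
  simp only [hp] at this
  exact this

theorem cX_rec {F : Type} [Field F] {n : ℕ} (t : F) (x : Fin (n+1) → F) (hx : Good t x)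
    (ε : Fin (n+1) → Bool) :
    cX t x ε = (∏ j, if ε j then (x j)⁻¹ else 1) * cR t x ε +
      t * ∑ j, if ε j then (1 - (x j)⁻¹) *
        (∏ i, if ε (j.succAbove i) then ph (x j)⁻¹ (x (j.succAbove i))⁻¹ else 1) *
          cX t (fun i => x (j.succAbove i)) (fun i => ε (j.succAbove i)) else 0 := by
  obtain ⟨W, ⟨h0, h1, h2, h3⟩, hp, hs⟩ := key_transfer t x hx ε (fun b => t + b)
  have := key2 W t hx.t0 hx.t1 h0 h1 h3
  rw [hs] at this
  simp only [hp] at this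
  exact this

theorem tm_shift {F : Type} [Field F] {n : ℕ} (C : ℤ) (t : F) (x : Fin n → F) (hx : Good t x)
    (ε : Fin n → Bool) :
    tm C t x ε * (∏ j, if ε j then (x j)⁻¹ else 1) = tm (C - 1) t x ε := by
  unfold tm
  rw [mul_right_comm, ← Finset.prod_mul_distrib]
  congr 1
  refine Finset.prod_congr rfl fun j _ => ?_
  split_ifs
  · rw [zpow_sub_one₀ (hx.x0 j)]
  · simp

theorem Sf_rec {F : Type} [Field F] {n : ℕ} (C : ℤ) (t : F) (x : Fin (n+1) → F) (hx : Good t x) :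
    Sf C t x = Rf (C - 1) t x + PP C x (fun j => Sf C t (fun i => x (j.succAbove i))) := by
  unfold Sf Rf
  rw [tm_rec C t x hx, ← Finset.sum_add_distrib]
  refine Finset.sum_congr rfl fun ε _ => ?_
  rw [← tm_shift C t x hx, mul_assoc, ← mul_add, ← cS_rec t x hx]

theorem Xf_rec {F : Type} [Field F] {n : ℕ} (C : ℤ) (t : F) (x : Fin (n+1) → F) (hx : Good t x) :
    Xf C t x = Rf (C - 1) t x + t * PP C x (fun j => Xf C t (fun i => x (j.succAbove i))) := by
  unfold Xf Rf
  rw [tm_rec C t x hx, Finset.mul_sum, ← Finset.sum_add_distrib]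
  refine Finset.sum_congr rfl fun ε _ => ?_
  rw [← tm_shift C t x hx, mul_assoc, mul_left_comm t, ← mul_add, ← cX_rec t x hx]

theorem Rf_eq {F : Type} [Field F] {n : ℕ} (C : ℤ) (t : F) (x : Fin n → F) :
    Rf C t x = (Sf C t x - t * Xf C t x) / (1 - t) := by
  unfold Rf Sf Xf cR
  rw [Finset.mul_sum, ← Finset.sum_sub_distrib, Finset.sum_div]
  refine Finset.sum_congr rfl fun ε _ => ?_
  ring

theorem PP_add {F : Type} [Field F] {n : ℕ} (e : ℤ) (x : Fin (n+1) → F) (a b : F)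
    (f g : Fin (n+1) → F) :
    PP e x (fun j => a * f j + b * g j) = a * PP e x f + b * PP e x g := by
  unfold PP
  rw [Finset.mul_sum, Finset.mul_sum, ← Finset.sum_add_distrib]
  exact Finset.sum_congr rfl fun _ _ => by ring

theorem Rf_rec {F : Type} [Field F] {n : ℕ} (C : ℤ) (t : F) (x : Fin (n+1) → F) (hx : Good t x) :
    Rf C t x = Xf C t x + PP C x (fun j => Rf C t (fun i => x (j.succAbove i))) := by
  have h1t : (1 - t) ≠ 0 := sub_ne_zero.mpr (Ne.symm hx.t1)
  have hS := Sf_rec C t x hx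
  have hX := Xf_rec C t x hx
  have : PP C x (fun j => Rf C t (fun i => x (j.succAbove i))) =
      (1 - t)⁻¹ * PP C x (fun j => Sf C t (fun i => x (j.succAbove i))) +
      (-t * (1 - t)⁻¹) * PP C x (fun j => Xf C t (fun i => x (j.succAbove i))) := by
    rw [← PP_add]
    congr 1
    funext j
    rw [Rf_eq]; ring
  rw [this, Rf_eq]
  field_simp
  linear_combination hS - hX


/-! ### Determinant side -/

/-- Numerator determinants. -/
def Dt {F : Type} [Field F] {n : ℕ} (N : ℤ) (x : Fin n → F) (κ : Fin n → ℕ) : F :=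
  Matrix.det (Matrix.of fun i j : Fin n => x j ^ (N - κ i) - x j ^ (κ i))

theorem Dt_expand {F : Type} [Field F] {n : ℕ} (N : ℤ) (x : Fin n → F) (hx : ∀ j, x j ≠ 0)
    (κ : Fin n → ℕ) :
    Dt N x κ = ∑ ε : Fin n → Bool, (∏ j, if ε j then x j ^ N else -1) *
      Matrix.det (Matrix.of fun i j : Fin n => ww x ε j ^ κ i) := by
  unfold Dt
  rw [← Matrix.det_transpose]
  have h : (Matrix.of fun i j : Fin n => x j ^ (N - κ i) - x j ^ (κ i)).transpose =
      fun j => ∑ b : Bool, (fun i => (if b then x j ^ N else -1) *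
        (if b then (x j)⁻¹ else x j) ^ κ i) := by
    ext j i
    have : x j ^ (N - κ i) = x j ^ N * ((x j)⁻¹) ^ κ i := by
      rw [zpow_sub₀ (hx j), zpow_natCast, inv_pow, div_eq_mul_inv]
    simp only [Matrix.transpose_apply, Matrix.of_apply, this]
    rw [Fintype.sum_bool]
    simp only [Pi.add_apply, if_true, Bool.false_eq_true, if_false]
    ring
  rw [h]
  have := (Matrix.detRowAlternating (n := Fin n) (R := F)).toMultilinearMap.map_sum
    (fun (j : Fin n) (b : Bool) (i : Fin n) => (if b then x j ^ N else -1) *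
        (if b then (x j)⁻¹ else x j) ^ κ i)
  refine this.trans ?_
  refine Finset.sum_congr rfl fun ε _ => ?_
  rw [← Matrix.det_transpose (Matrix.of _)]
  exact Matrix.det_mul_column (fun j => if ε j then x j ^ N else -1)
    (Matrix.of fun i j : Fin n => ww x ε j ^ κ i).transpose

theorem vand_gen {F : Type} [Field F] {n : ℕ} (t : F) (ht : t ≠ 0) (w : Fin n → F) :
    ∑ k : Fin (n+1), t ^ (n - (k:ℕ)) *
      Matrix.det (Matrix.of fun i j : Fin n => w j ^ ((k.succAbove i : Fin (n+1)) : ℕ))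
    = (∏ j, (1 + t * w j)) * pp (fun i j => w j - w i) := by
  have h := Matrix.det_vandermonde (Fin.cons (-t⁻¹) w : Fin (n+1) → F)
  rw [Matrix.det_succ_row_zero] at h
  rw [← pp_eq_Ioi (fun i j => (Fin.cons (-t⁻¹) w : Fin (n+1) → F) j -
    (Fin.cons (-t⁻¹) w : Fin (n+1) → F) i), pp_succAbove _ 0] at h
  simp only [Fin.succAbove_zero, Fin.succ_pos, if_true, Fin.cons_succ, Fin.cons_zero,
    Matrix.vandermonde_apply] at h
  have h2 : ∏ j, (1 + t * w j) = t ^ n * ∏ j, (w j - -t⁻¹) := by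
    have : t ^ n = ∏ _j : Fin n, t := by simp
    rw [this, ← Finset.prod_mul_distrib]
    exact Finset.prod_congr rfl fun j _ => by field_simp; ring
  rw [h2, mul_assoc, ← h, Finset.mul_sum]
  refine Finset.sum_congr rfl fun k _ => ?_
  rw [← mul_assoc (t ^ n), ← mul_assoc (t ^ n)]
  congr 1
  · have hk : n = (n - (k:ℕ)) + k := by omega
    rw [mul_assoc, ← mul_pow, show (-1) * -t⁻¹ = t⁻¹ by ring]
    have hk2 : t ^ n = t ^ (n - (k:ℕ)) * t ^ (k:ℕ) := by rw [← pow_add, ← hk]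
    rw [hk2, mul_assoc, ← mul_pow, mul_inv_cancel₀ ht]
    simp
  · rw [← Matrix.det_transpose]
    congr 1

/-- Common denominator. -/
def KV {F : Type} [Field F] {n : ℕ} (x : Fin n → F) : F :=
  (∏ j, (x j - 1)) * pp (fun i j => x i * x j - 1) * pp (fun i j => x i - x j)

theorem KV_ne {F : Type} [Field F] {n : ℕ} {t : F} {x : Fin n → F} (hx : Good t x) :
    KV x ≠ 0 := by
  refine mul_ne_zero (mul_ne_zero ?_ ?_) ?_
  · exact Finset.prod_ne_zero_iff.mpr fun j _ => sub_ne_zero.mpr (hx.x1 j)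
  · exact pp_ne_zero fun a b h => sub_ne_zero.mpr (hx.mul a b h.ne)
  · exact pp_ne_zero fun a b h => sub_ne_zero.mpr fun h' => h.ne (hx.inj h')

theorem KV_gg {F : Type} [Field F] {n : ℕ} {t : F} {x : Fin n → F} (hx : Good t x)
    (ε : Fin n → Bool) :
    KV x * gg (ww x ε) = (∏ j, if ε j then x j ^ (2 * (n:ℤ) - 1) else -1) *
      pp (fun i j => ww x ε j - ww x ε i) := by
  unfold KV gg
  rw [← pp_inv, ← Finset.prod_inv_distrib]
  have h1 : (∏ j, (x j - 1)) * (∏ j, (1 - ww x ε j)⁻¹) = ∏ j, if ε j then x j else -1 := by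
    rw [← Finset.prod_mul_distrib]
    refine Finset.prod_congr rfl fun j _ => ?_
    have a0 := hx.x0 j
    have a1 : x j - 1 ≠ 0 := sub_ne_zero.mpr (hx.x1 j)
    unfold ww
    split_ifs
    · have : 1 - (x j)⁻¹ = (x j - 1) / x j := by field_simp
      rw [this]; field_simp
    · have : 1 - x j = -(x j - 1) := by ring
      rw [this, inv_neg]; field_simp
  have h2 : pp (fun i j => x i * x j - 1) * pp (fun i j => x i - x j) *
      pp (fun i j => (1 - ww x ε i * ww x ε j)⁻¹) =
      pp (fun i j => (if ε i then x i ^ 2 else 1) * (if ε j then x j ^ 2 else 1)) *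
        pp (fun i j => ww x ε j - ww x ε i) := by
    rw [← pp_mul, ← pp_mul, ← pp_mul]
    refine pp_congr fun i j hij => ?_
    have i0 := hx.x0 i
    have j0 := hx.x0 j
    have m : x i * x j - 1 ≠ 0 := sub_ne_zero.mpr (hx.mul i j hij.ne)
    have s : x i - x j ≠ 0 := sub_ne_zero.mpr fun h => hij.ne (hx.inj h)
    unfold ww
    cases ε i <;> cases ε j <;> simp only [if_true, Bool.false_eq_true, if_false]
    · rw [show 1 - x i * x j = -(x i * x j - 1) by ring, inv_neg]; field_simp; ring
    · rw [show 1 - x i * (x j)⁻¹ = -(x i - x j) / x j by field_simp; ring, inv_div, div_neg]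
      field_simp; ring
    · rw [show 1 - (x i)⁻¹ * x j = (x i - x j) / x i by field_simp, inv_div]
      field_simp
    · rw [show 1 - (x i)⁻¹ * (x j)⁻¹ = (x i * x j - 1) / (x i * x j) by field_simp, inv_div]
      field_simp
  rw [pp_pow] at h2
  have h3 : (∏ j, if ε j then x j ^ (2 * (n:ℤ) - 1) else -1) =
      (∏ j, if ε j then x j else -1) * ∏ j, (if ε j then x j ^ 2 else 1) ^ (n - 1) := by
    rw [← Finset.prod_mul_distrib]
    refine Finset.prod_congr rfl fun j _ => ?_
    have hn : 1 ≤ n := by have := j.2; omega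
    split_ifs
    · rw [← pow_mul, ← pow_succ', ← zpow_natCast]
      congr 1
      push_cast [hn]
      ring
    · simp
  rw [h3, mul_assoc _ _ (pp fun i j => ww x ε j - ww x ε i), ← h2, ← h1]
  ring

theorem det_pp {F : Type} [Field F] {n : ℕ} (w : Fin n → F) :
    Matrix.det (Matrix.of fun i j : Fin n => w j ^ (i : ℕ)) = pp (fun i j => w j - w i) := by
  rw [pp_eq_Ioi, ← Matrix.det_vandermonde, ← Matrix.det_transpose]
  congr 1

theorem KV_Sf {F : Type} [Field F] {n : ℕ} (C : ℤ) {t : F} {x : Fin n → F} (hx : Good t x) :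
    KV x * Sf C t x = ∑ k : Fin (n+1), t ^ (n - (k:ℕ)) *
      Dt (C + (2 * (n:ℤ) - 1)) x (fun i => (k.succAbove i : ℕ)) := by
  unfold Sf
  simp only [Dt_expand _ x hx.x0, Finset.mul_sum]
  rw [Finset.sum_comm]
  refine Finset.sum_congr rfl fun ε _ => ?_
  have : ∀ k : Fin (n+1), t ^ (n - (k:ℕ)) * ((∏ j, if ε j then x j ^ (C + (2 * (n:ℤ) - 1)) else -1) *
      Matrix.det (Matrix.of fun i j : Fin n => ww x ε j ^ (k.succAbove i : ℕ)))
     = (∏ j, if ε j then x j ^ (C + (2 * (n:ℤ) - 1)) else -1) * (t ^ (n - (k:ℕ)) *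
      Matrix.det (Matrix.of fun i j : Fin n => ww x ε j ^ (k.succAbove i : ℕ))) := by
    intro k; ring
  simp only [this]
  rw [← Finset.mul_sum, vand_gen t hx.t0]
  unfold tm cS
  have e1 : (∏ j, if ε j then x j ^ C else 1 + t * x j) * (∏ j, if ε j then 1 + t * (x j)⁻¹ else 1)
    = (∏ j, if ε j then x j ^ C else 1) * ∏ j, (1 + t * ww x ε j) := by
    rw [← Finset.prod_mul_distrib, ← Finset.prod_mul_distrib]
    refine Finset.prod_congr rfl fun j _ => ?_
    unfold ww
    split_ifs <;> ring
  have e2 : (∏ j, if ε j then x j ^ (C + (2 * (n:ℤ) - 1)) else -1) =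
    (∏ j, if ε j then x j ^ C else 1) * (∏ j, if ε j then x j ^ (2 * (n:ℤ) - 1) else -1) := by
    rw [← Finset.prod_mul_distrib]
    refine Finset.prod_congr rfl fun j _ => ?_
    split_ifs
    · rw [zpow_add₀ (hx.x0 j)]
    · simp
  rw [e2]
  have := KV_gg hx ε
  linear_combination (gg (ww x ε) * KV x) * e1 +
    ((∏ j, if ε j then x j ^ C else 1) * ∏ j, (1 + t * ww x ε j)) * this

theorem KV_Xf {F : Type} [Field F] {n : ℕ} (C : ℤ) {t : F} {x : Fin n → F} (hx : Good t x) :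
    KV x * Xf C t x = (∏ j, (1 + t * x j)) *
      Dt (C - 1 + (2 * (n:ℤ) - 1)) x (fun i => (i : ℕ)) := by
  unfold Xf
  simp only [Dt_expand _ x hx.x0, Finset.mul_sum, det_pp]
  refine Finset.sum_congr rfl fun ε _ => ?_
  unfold tm cX
  have e1 : (∏ j, if ε j then x j ^ C else 1 + t * x j) * (∏ j, if ε j then t + (x j)⁻¹ else 1)
    = (∏ j, if ε j then x j ^ (C - 1) else 1) * ∏ j, (1 + t * x j) := by
    rw [← Finset.prod_mul_distrib, ← Finset.prod_mul_distrib]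
    refine Finset.prod_congr rfl fun j _ => ?_
    have := hx.x0 j
    split_ifs
    · rw [zpow_sub_one₀ (hx.x0 j)]; field_simp; ring
    · ring
  have e2 : (∏ j, if ε j then x j ^ (C - 1 + (2 * (n:ℤ) - 1)) else -1) =
    (∏ j, if ε j then x j ^ (C - 1) else 1) * (∏ j, if ε j then x j ^ (2 * (n:ℤ) - 1) else -1) := by
    rw [← Finset.prod_mul_distrib]
    refine Finset.prod_congr rfl fun j _ => ?_
    split_ifs
    · rw [zpow_add₀ (hx.x0 j)]
    · simp
  rw [e2]
  have := KV_gg hx ε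
  linear_combination (gg (ww x ε) * KV x) * e1 +
    ((∏ j, if ε j then x j ^ (C - 1) else 1) * ∏ j, (1 + t * x j)) * this

theorem Xf_zero {F : Type} [Field F] {n : ℕ} {t : F} {x : Fin (n+1) → F} (hx : Good t x) :
    Xf 0 t x = 0 := by
  apply mul_left_cancel₀ (KV_ne hx)
  rw [KV_Xf 0 hx, mul_zero]
  have : Dt (0 - 1 + (2 * ((n+1 : ℕ):ℤ) - 1)) x (fun i => (i : ℕ)) = 0 := by
    unfold Dt
    apply Matrix.det_eq_zero_of_row_eq_zero (Fin.last n)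
    intro j
    have : (0 - 1 + (2 * ((n+1 : ℕ):ℤ) - 1) - ((Fin.last n : Fin (n+1)) : ℕ)) = (n : ℤ) := by
      push_cast [Fin.val_last]; ring
    simp only [Matrix.of_apply]
    rw [this]; simp
  rw [this, mul_zero]

theorem form_empty {F : Type} [Field F] (C : ℤ) {t : F} (ht : t ≠ 1) (x : Fin 0 → F) :
    Sf C t x = 1 ∧ Xf C t x = 1 ∧ Rf C t x = 1 := by
  have h1t : (1 - t) ≠ 0 := sub_ne_zero.mpr (Ne.symm ht)
  simp [Sf, Xf, Rf, cR, tm, cS, cX, gg, pp, h1t]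


/-! ### Schur functions as ratios of alternants -/

/-- Natural-index version of `hpoly`. -/
def hp {R : Type} [CommRing R] {N : ℕ} (x : Fin N → R) (m : ℕ) : R :=
  ∑ f ∈ Finset.univ.filter (fun f : Fin m → Fin N => Monotone f), ∏ i, x (f i)

theorem hpoly_nat {R : Type} [CommRing R] {N : ℕ} (x : Fin N → R) (m : ℕ) :
    hpoly x (m : ℤ) = hp x m := by
  unfold hpoly
  rw [if_pos (Int.natCast_nonneg m)]
  rfl

theorem hpoly_neg {R : Type} [CommRing R] {N : ℕ} (x : Fin N → R) (m : ℤ) (h : m < 0) :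
    hpoly x m = 0 := by
  unfold hpoly
  rw [if_neg (not_le.mpr h)]

theorem hp_zero {R : Type} [CommRing R] {N : ℕ} (x : Fin N → R) : hp x 0 = 1 := by
  unfold hp
  have h : ∀ f : Fin 0 → Fin N, Monotone f := fun f a => a.elim0
  simp [h]

theorem hp_succ {R : Type} [CommRing R] {N : ℕ} (x : Fin (N+1) → R) (k : ℕ) :
    hp x (k+1) = hp (fun i => x i.succ) (k+1) + x 0 * hp x k := by
  unfold hp
  rw [← Finset.sum_filter_add_sum_filter_not _ (fun f : Fin (k+1) → Fin (N+1) => f 0 ≠ 0)]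
  congr 1
  · symm
    refine Finset.sum_nbij (fun g i => (g i).succ) ?_ ?_ ?_ ?_
    · intro g hg
      simp only [Finset.mem_filter, Finset.mem_univ, true_and] at hg ⊢
      exact ⟨fun a b h => Fin.succ_le_succ_iff.mpr (hg h), Fin.succ_ne_zero _⟩
    · intro g _ g' _ h
      funext i
      exact Fin.succ_injective _ (congrFun h i)
    · intro f hf
      simp only [Finset.coe_filter, Finset.mem_filter, Finset.mem_univ, true_and,
        Set.mem_ofPred_eq] at hf
      have hne : ∀ i, f i ≠ 0 := fun i h => hf.2 (Fin.le_zero_iff.mp (h ▸ hf.1 (Fin.zero_le i)))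
      refine ⟨fun i => (f i).pred (hne i), ?_, ?_⟩
      · simp only [Finset.coe_filter, Finset.mem_univ, true_and, Set.mem_ofPred_eq]
        exact fun a b h => Fin.pred_le_pred_iff.mpr (hf.1 h)
      · funext i; simp
    · intro g _; rfl
  · rw [Finset.mul_sum]
    symm
    refine Finset.sum_nbij (fun g => (Fin.cons 0 g : Fin (k+1) → Fin (N+1))) ?_ ?_ ?_ ?_
    · intro g hg
      simp only [Finset.mem_filter, Finset.mem_univ, true_and] at hg ⊢
      refine ⟨?_, by simp⟩
      intro a b h
      refine Fin.cases ?_ (fun a => ?_) a h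
      · intro _; simp
      · intro h
        refine Fin.cases ?_ (fun b => ?_) b h
        · intro h; exact absurd h (by simp)
        · intro h; simpa using hg (Fin.succ_le_succ_iff.mp h)
    · intro g _ g' _ h
      exact (Fin.cons_injective2 h).2
    · intro f hf
      simp only [Finset.coe_filter, Finset.mem_filter, Finset.mem_univ, true_and,
        Set.mem_ofPred_eq, not_not, ne_eq] at hf
      refine ⟨Fin.tail f, ?_, ?_⟩
      · simp only [Finset.coe_filter, Finset.mem_univ, true_and, Set.mem_ofPred_eq]
        exact fun a b h => hf.1 (Fin.succ_le_succ_iff.mpr h)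
      · show (Fin.cons 0 (Fin.tail f) : Fin (k+1) → Fin (N+1)) = f
        rw [← hf.2]; exact Fin.cons_self_tail f
    · intro g _
      rw [Fin.prod_univ_succ]; simp

theorem hpoly_rec {R : Type} [CommRing R] {N : ℕ} (x : Fin (N+1) → R) (m : ℤ) :
    hpoly x m = hpoly (fun i => x i.succ) m + x 0 * hpoly x (m-1) := by
  rcases lt_trichotomy m 0 with h | h | h
  · rw [hpoly_neg _ _ h, hpoly_neg _ _ h, hpoly_neg _ _ (by omega)]; simp
  · subst h
    rw [hpoly_neg _ (0 - 1) (by omega)]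
    have := hpoly_nat x 0
    have h2 := hpoly_nat (fun i : Fin N => x i.succ) 0
    simp only [Nat.cast_zero, hp_zero] at this h2
    rw [this, h2]; simp
  · obtain ⟨k, rfl⟩ : ∃ k : ℕ, m = ((k+1 : ℕ) : ℤ) := ⟨(m-1).toNat, by omega⟩
    have : (((k+1 : ℕ) : ℤ) - 1) = (k : ℤ) := by push_cast; ring
    rw [this, hpoly_nat, hpoly_nat, hpoly_nat, hp_succ]

theorem sum_inv_zero {F : Type} [Field F] {N : ℕ} (x : Fin (N+2) → F) (hx : Function.Injective x) :
    ∑ j, 1 / (∏ i, (x j - x (j.succAbove i))) = 0 := by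
  have h := lagr_zero (Finset.univ.map ⟨x, hx⟩) (1 : Polynomial F) (by simp)
  rw [Finset.sum_map] at h
  rw [← h]
  refine Finset.sum_congr rfl fun j _ => ?_
  rw [← Finset.map_erase, Finset.prod_map]
  simp only [Polynomial.eval_one, Function.Embedding.coeFn_mk]
  congr 1
  have : (Finset.univ.erase j) = Finset.univ.filter (fun i => i ≠ j) := by
    ext; simp
  rw [this, Finset.prod_filter, Fin.prod_univ_succAbove _ j]
  simp [Fin.succAbove_ne]

theorem hpoly_formula {F : Type} [Field F] (N : ℕ) : ∀ (x : Fin (N+1) → F)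
    (_ : Function.Injective x) (e : ℕ),
    hpoly x ((e : ℤ) - N) = ∑ j, x j ^ e / (∏ i, (x j - x (j.succAbove i))) := by
  induction N with
  | zero =>
    intro x _ e
    simp only [Nat.cast_zero, sub_zero, Finset.univ_unique, Finset.univ_eq_empty,
      Finset.prod_empty, div_one, Finset.sum_singleton]
    rw [hpoly_nat]
    induction e with
    | zero => simp [hp_zero]
    | succ e ih =>
      rw [hp_succ, ih]
      have : hp (fun i : Fin 0 => x i.succ) (e+1) = 0 := by
        unfold hp
        apply Finset.sum_eq_zero
        intro f _
        exact (f 0).elim0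
      rw [this]
      simp [pow_succ']
  | succ N ih =>
    intro x hx e
    induction e with
    | zero =>
      rw [hpoly_neg _ _ (by push_cast; omega)]
      simp only [pow_zero]
      exact (sum_inv_zero x hx).symm
    | succ e ihe =>
      rw [hpoly_rec]
      have h1 : (((e+1 : ℕ) : ℤ) - ((N+1 : ℕ) : ℤ)) = (e : ℤ) - N := by push_cast; ring
      have h2 : (((e+1 : ℕ) : ℤ) - ((N+1 : ℕ) : ℤ) - 1) = (e : ℤ) - ((N+1 : ℕ) : ℤ) := by
        push_cast; ring
      rw [h2, ihe, h1, ih (fun i => x i.succ) (hx.comp (Fin.succ_injective _)) e]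
      have h3 : ∑ j : Fin (N+1), x j.succ ^ e / (∏ i, (x j.succ - x (j.succAbove i).succ))
        = ∑ j, x j ^ e * (x j - x 0) / (∏ i, (x j - x (j.succAbove i))) := by
        rw [Fin.sum_univ_succ (n := N+1)]
        simp only [sub_self, mul_zero, zero_div, zero_add]
        refine Finset.sum_congr rfl fun j _ => ?_
        rw [Fin.prod_univ_succ (n := N)]
        simp only [Fin.succ_succAbove_zero, Fin.succ_succAbove_succ]
        have : x j.succ - x 0 ≠ 0 := sub_ne_zero.mpr fun h => Fin.succ_ne_zero j (hx h)
        rw [mul_comm (x j.succ ^ e), mul_div_mul_left _ _ this]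
      rw [h3, Finset.mul_sum, ← Finset.sum_add_distrib]
      refine Finset.sum_congr rfl fun j _ => ?_
      rw [pow_succ]; ring

/-- Alternant. -/
def al {F : Type} [Field F] {n : ℕ} (ν : Fin n → ℕ) (x : Fin n → F) : F :=
  Matrix.det (Matrix.of fun i j : Fin n => x j ^ (ν i + (i.rev : ℕ)))

theorem al_zero {F : Type} [Field F] {n : ℕ} (x : Fin n → F) :
    al (fun _ => 0) x = pp (fun i j => x i - x j) := by
  have h := Matrix.det_projVandermonde (fun _ => 1) x
  rw [pp_eq_Ioi]
  simp only [one_mul, mul_one] at h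
  rw [← h, ← Matrix.det_transpose]
  unfold al
  congr 1
  ext i j
  simp [Matrix.projVandermonde_apply]

theorem schur_al {F : Type} [Field F] {N : ℕ} (ν : Fin (N+1) → ℕ) (x : Fin (N+1) → F)
    (hx : Function.Injective x) :
    schur (fun i => (ν i : ℤ)) x = al ν x *
      Matrix.det (Matrix.of fun j k : Fin (N+1) => x j ^ (k : ℕ) / ∏ i, (x j - x (j.succAbove i))) := by
  unfold schur al
  rw [← Matrix.det_mul]
  congr 1
  ext i k
  simp only [Matrix.of_apply, Matrix.mul_apply]
  have : (ν i : ℤ) - ((i : ℕ) : ℤ) + ((k : ℕ) : ℤ) = ((ν i + (i.rev : ℕ) + (k : ℕ) : ℕ) : ℤ) - N := by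
    rw [Fin.val_rev]
    have := i.2
    omega
  rw [this, hpoly_formula N x hx]
  refine Finset.sum_congr rfl fun j _ => ?_
  rw [pow_add]; ring

theorem schur_zero {R : Type} [CommRing R] {N n : ℕ} (x : Fin N → R) :
    schur (fun _ : Fin n => ((0 : ℕ) : ℤ)) x = 1 := by
  unfold schur
  rw [Matrix.det_of_isUpperTriangular]
  · apply Finset.prod_eq_one
    intro i _
    have := hpoly_nat x 0
    simp only [Matrix.of_apply]
    rw [show ((0:ℕ):ℤ) - ((i:ℕ):ℤ) + ((i:ℕ):ℤ) = ((0:ℕ):ℤ) by ring, this, hp_zero]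
  · intro i j h
    simp only [Matrix.of_apply]
    apply hpoly_neg
    have : (j:ℕ) < i := h
    push_cast; omega

/-- Normalized alternant. -/
def sg {F : Type} [Field F] {n : ℕ} (ν : Fin n → ℕ) (x : Fin n → F) : F :=
  al ν x / pp (fun i j => x i - x j)

theorem pp_sub_ne {F : Type} [Field F] {n : ℕ} (x : Fin n → F) (hx : Function.Injective x) :
    pp (fun i j => x i - x j) ≠ 0 :=
  pp_ne_zero fun a b h => sub_ne_zero.mpr fun h' => h.ne (hx h')

theorem sg_zero {F : Type} [Field F] {n : ℕ} (x : Fin n → F) (hx : Function.Injective x) :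
    sg (fun _ => 0) x = 1 := by
  unfold sg
  rw [al_zero, div_self (pp_sub_ne x hx)]

theorem schur_eq_sg {F : Type} [Field F] {N : ℕ} (ν : Fin (N+1) → ℕ) (x : Fin (N+1) → F)
    (hx : Function.Injective x) :
    schur (fun i => (ν i : ℤ)) x = sg ν x := by
  have h0 := schur_al (fun _ => 0) x hx
  rw [schur_zero, al_zero] at h0
  rw [schur_al ν x hx]
  unfold sg
  rw [eq_div_iff (pp_sub_ne x hx), mul_assoc]
  rw [mul_comm (Matrix.det _), ← h0, mul_one]

theorem prod_sign {F : Type} [Field F] {n : ℕ} (j : Fin (n+1)) (u : Fin n → F) :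
    (∏ i, if j < j.succAbove i then u i else - u i) = (-1)^(j:ℕ) * ∏ i, u i := by
  have h : ∀ i : Fin n, (if j < j.succAbove i then u i else - u i) =
      (if (j:ℕ) ≤ (i:ℕ) then 1 else -1) * u i := by
    intro i
    have : j < j.succAbove i ↔ (j:ℕ) ≤ (i:ℕ) := by
      rw [Fin.lt_succAbove_iff_le_castSucc]; rfl
    simp only [this]
    split_ifs <;> ring
  simp only [h]
  rw [Finset.prod_mul_distrib]
  congr 1
  rw [Fin.prod_univ_eq_prod_range (fun i => if (j:ℕ) ≤ i then (1:F) else -1) n, Finset.prod_ite]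
  simp only [Finset.prod_const_one, one_mul, Finset.prod_const]
  congr 1
  have : (Finset.range n).filter (fun i => ¬ (j:ℕ) ≤ i) = Finset.range j := by
    ext i; simp; omega
  rw [this, Finset.card_range]

theorem sg_cons {F : Type} [Field F] {n : ℕ} (a : ℕ) (ν : Fin n → ℕ) (x : Fin (n+1) → F)
    (hx : Function.Injective x) :
    sg (Fin.cons a ν : Fin (n+1) → ℕ) x = PP (a : ℤ) x (fun j => sg ν (fun i => x (j.succAbove i))) := by
  unfold sg PP
  have h : al (Fin.cons a ν : Fin (n+1) → ℕ) x = ∑ j : Fin (n+1), (-1)^(j:ℕ) * x j ^ (a + n) *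
      al ν (fun i => x (j.succAbove i)) := by
    unfold al
    rw [Matrix.det_succ_row_zero]
    refine Finset.sum_congr rfl fun j _ => ?_
    congr 1
    · congr 1
      ext i k
      simp only [Matrix.submatrix_apply, Matrix.of_apply, Fin.cons_succ, Fin.rev_succ, Fin.val_castSucc]
  rw [h, Finset.sum_div]
  refine Finset.sum_congr rfl fun j _ => ?_
  rw [pp_succAbove _ j]
  have h2 := prod_sign j (fun i => x j - x (j.succAbove i))
  simp only [neg_sub] at h2
  rw [h2]
  have hs : ((-1:F)^(j:ℕ)) ≠ 0 := pow_ne_zero _ (by simp)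
  rw [mul_assoc, mul_assoc, mul_div_mul_left _ _ hs, mul_div_mul_comm]
  congr 2
  rw [← zpow_natCast]; push_cast; rfl


/-! ### Sums over vertical strips -/

/-- Pairs `(ν, ρ)` with `ν/ρ` a vertical strip and a condition on rows. -/
def pairsA (n C : ℕ) (Q : ℕ → ℕ → Prop) : Finset ((Fin n → ℕ) × (Fin n → ℕ)) :=
  ((Fintype.piFinset fun _ : Fin n => Finset.range (C + 1)) ×ˢ
    (Fintype.piFinset fun _ : Fin n => Finset.range (C + 1))).filter
    (fun q => Antitone q.1 ∧ Antitone q.2 ∧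
      ∀ i, q.2 i ≤ q.1 i ∧ q.1 i ≤ q.2 i + 1 ∧ Q (q.1 i) (q.2 i))

theorem mem_pairsA {n C : ℕ} {Q : ℕ → ℕ → Prop} {q : (Fin n → ℕ) × (Fin n → ℕ)} :
    q ∈ pairsA n C Q ↔ Antitone q.1 ∧ Antitone q.2 ∧
      ∀ i, q.1 i ≤ C ∧ q.2 i ≤ q.1 i ∧ q.1 i ≤ q.2 i + 1 ∧ Q (q.1 i) (q.2 i) := by
  unfold pairsA
  simp only [Finset.mem_filter, Finset.mem_product, Fintype.mem_piFinset, Finset.mem_range]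
  constructor
  · rintro ⟨⟨h1, h2⟩, h3, h4, h5⟩
    exact ⟨h3, h4, fun i => ⟨by have := h1 i; omega, h5 i⟩⟩
  · rintro ⟨h3, h4, h5⟩
    exact ⟨⟨fun i => by have := h5 i; omega, fun i => by have := h5 i; omega⟩, h3, h4,
      fun i => (h5 i).2⟩

/-- Number of cells. -/
def cells {n : ℕ} (q : (Fin n → ℕ) × (Fin n → ℕ)) : ℕ :=
  (Finset.univ.filter (fun i : Fin n => q.2 i < q.1 i)).card

/-- Weighted sum. -/
def Wsum {F : Type} [Field F] (n C : ℕ) (Q : ℕ → ℕ → Prop) (t : F) (G : (Fin n → ℕ) → F) : F :=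
  ∑ q ∈ pairsA n C Q, t ^ cells q * G q.1

theorem cells_cons {n : ℕ} (a b : ℕ) (q : (Fin n → ℕ) × (Fin n → ℕ)) :
    cells ((Fin.cons a q.1 : Fin (n+1) → ℕ), (Fin.cons b q.2 : Fin (n+1) → ℕ)) =
      (if b < a then 1 else 0) + cells q := by
  unfold cells
  simp only [Finset.card_filter]
  rw [Fin.sum_univ_succ]
  simp only [Fin.cons_zero, Fin.cons_succ]

theorem antitone_cons {n : ℕ} (a : ℕ) (ν : Fin n → ℕ) :
    Antitone (Fin.cons a ν : Fin (n+1) → ℕ) ↔ Antitone ν ∧ ∀ i, ν i ≤ a := by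
  constructor
  · intro h
    refine ⟨fun i j hij => ?_, fun i => ?_⟩
    · simpa using h (Fin.succ_le_succ_iff.mpr hij)
    · simpa using h (Fin.zero_le i.succ)
  · rintro ⟨h1, h2⟩ i j
    refine Fin.cases ?_ (fun i => ?_) i
    · intro _
      refine Fin.cases ?_ (fun j => ?_) j
      · simp
      · simpa using h2 j
    · refine Fin.cases ?_ (fun j => ?_) j
      · intro h; exact absurd h (by simp)
      · intro h; simpa using h1 (Fin.succ_le_succ_iff.mp h)

theorem Wsum_peel {F : Type} [Field F] {n C : ℕ} {Q Q' : ℕ → ℕ → Prop} (t : F)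
    (G : (Fin (n+1) → ℕ) → F) (b : ℕ) (hb : b ≤ C) (hb' : C ≤ b + 1) (hQ : Q C b)
    (hQ' : ∀ a' b', a' ≤ C → b' ≤ a' → a' ≤ b' + 1 → (Q' a' b' ↔ Q a' b' ∧ b' ≤ b)) :
    ∑ q ∈ (pairsA (n+1) C Q).filter (fun q => q.1 0 = C ∧ q.2 0 = b), t ^ cells q * G q.1
      = (if b < C then t else 1) * Wsum n C Q' t (fun ν => G (Fin.cons C ν)) := by
  unfold Wsum
  rw [Finset.mul_sum]
  symm
  refine Finset.sum_nbij (fun q => ((Fin.cons C q.1 : Fin (n+1) → ℕ), (Fin.cons b q.2 : Fin (n+1) → ℕ)))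
    ?_ ?_ ?_ ?_
  · intro q hq
    rw [mem_pairsA] at hq
    obtain ⟨h1, h2, h3⟩ := hq
    rw [Finset.mem_filter, mem_pairsA]
    refine ⟨⟨?_, ?_, ?_⟩, by simp, by simp⟩
    · exact (antitone_cons _ _).mpr ⟨h1, fun i => (h3 i).1⟩
    · refine (antitone_cons _ _).mpr ⟨h2, fun i => ?_⟩
      obtain ⟨a1, a2, a3, a4⟩ := h3 i
      exact ((hQ' _ _ a1 a2 a3).mp a4).2
    · intro i
      refine Fin.cases ?_ (fun i => ?_) i
      · simpa using ⟨hb, hb', hQ⟩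
      · obtain ⟨a1, a2, a3, a4⟩ := h3 i
        simpa using ⟨a1, a2, a3, ((hQ' _ _ a1 a2 a3).mp a4).1⟩
  · intro q _ q' _ h
    simp only [Prod.mk.injEq] at h
    exact Prod.ext (Fin.cons_injective2 h.1).2 (Fin.cons_injective2 h.2).2
  · intro q hq
    rw [Finset.mem_coe, Finset.mem_filter, mem_pairsA] at hq
    obtain ⟨⟨h1, h2, h3⟩, h4, h5⟩ := hq
    have e1 : (Fin.cons C (Fin.tail q.1) : Fin (n+1) → ℕ) = q.1 := by
      rw [← h4]; exact Fin.cons_self_tail _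
    have e2 : (Fin.cons b (Fin.tail q.2) : Fin (n+1) → ℕ) = q.2 := by
      rw [← h5]; exact Fin.cons_self_tail _
    refine ⟨(Fin.tail q.1, Fin.tail q.2), ?_, Prod.ext e1 e2⟩
    rw [Finset.mem_coe, mem_pairsA]
    rw [← e1, antitone_cons] at h1
    rw [← e2, antitone_cons] at h2
    refine ⟨h1.1, h2.1, fun i => ?_⟩
    obtain ⟨a1, a2, a3, a4⟩ := h3 i.succ
    exact ⟨a1, a2, a3, (hQ' _ _ a1 a2 a3).mpr ⟨a4, h2.2 i⟩⟩
  · intro q _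
    simp only
    rw [cells_cons, pow_add]
    split_ifs <;> simp [mul_assoc]

theorem Wsum_low {F : Type} [Field F] {n C : ℕ} {Q : ℕ → ℕ → Prop} (t : F)
    (G : (Fin (n+1) → ℕ) → F) (hQ : ∀ a b, a ≤ C → b ≤ a → Q a b) :
    ∑ q ∈ (pairsA (n+1) (C+1) Q).filter (fun q => q.1 0 ≤ C), t ^ cells q * G q.1
      = Wsum (n+1) C (fun _ _ => True) t G := by
  unfold Wsum
  refine Finset.sum_congr ?_ fun _ _ => rfl
  ext q
  rw [Finset.mem_filter, mem_pairsA, mem_pairsA]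
  constructor
  · rintro ⟨⟨h1, h2, h3⟩, h4⟩
    exact ⟨h1, h2, fun i => ⟨(h1 (Fin.zero_le i)).trans h4, (h3 i).2.1, (h3 i).2.2.1, trivial⟩⟩
  · rintro ⟨h1, h2, h3⟩
    exact ⟨⟨h1, h2, fun i => ⟨by have := h3 i; omega, (h3 i).2.1, (h3 i).2.2.1,
      hQ _ _ (h3 i).1 (h3 i).2.1⟩⟩, (h3 0).1⟩

/-- All vertical strips. -/
def qR : ℕ → ℕ → Prop := fun _ _ => True
/-- No cell in column `C`. -/
def qS (C : ℕ) : ℕ → ℕ → Prop := fun a b => b < a → a ≠ C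
/-- Every row reaching column `C` has a cell there. -/
def qX (C : ℕ) : ℕ → ℕ → Prop := fun a b => a = C → b < a

theorem Wsum_S {F : Type} [Field F] (n C : ℕ) (t : F) (G : (Fin (n+1) → ℕ) → F) :
    Wsum (n+1) (C+1) (qS (C+1)) t G = Wsum (n+1) C qR t G +
      Wsum n (C+1) (qS (C+1)) t (fun ν => G (Fin.cons (C+1) ν)) := by
  have h1 := Wsum_low (C := C) (Q := qS (C+1)) t G (fun a b h _ _ => by omega)
  have h2 := Wsum_peel (C := C+1) (Q := qS (C+1)) (Q' := qS (C+1)) t G (C+1) le_rfl (by omega)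
    (fun h => by omega) (fun a b _ _ _ => by unfold qS; constructor <;> intro h <;> omega)
  rw [if_neg (lt_irrefl _), one_mul] at h2
  rw [show qR = fun _ _ => True from rfl, ← h1, ← h2]
  conv_lhs => unfold Wsum
  rw [← Finset.sum_filter_add_sum_filter_not _ (fun q => q.1 0 ≤ C)]
  congr 1
  refine Finset.sum_congr (Finset.filter_congr fun q hq => ?_) fun _ _ => rfl
  rw [mem_pairsA] at hq
  have := hq.2.2 0
  unfold qS at this
  omega

theorem Wsum_X {F : Type} [Field F] (n C : ℕ) (t : F) (G : (Fin (n+1) → ℕ) → F) :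
    Wsum (n+1) (C+1) (qX (C+1)) t G = Wsum (n+1) C qR t G +
      t * Wsum n (C+1) (qX (C+1)) t (fun ν => G (Fin.cons (C+1) ν)) := by
  have h1 := Wsum_low (C := C) (Q := qX (C+1)) t G (fun a b h _ _ => by omega)
  have h2 := Wsum_peel (C := C+1) (Q := qX (C+1)) (Q' := qX (C+1)) t G C (by omega) (by omega)
    (fun h => by omega) (fun a b _ _ _ => by unfold qX; constructor <;> intro h <;> omega)
  rw [if_pos (Nat.lt_succ_self _)] at h2
  rw [show qR = fun _ _ => True from rfl, ← h1, ← h2]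
  conv_lhs => unfold Wsum
  rw [← Finset.sum_filter_add_sum_filter_not _ (fun q => q.1 0 ≤ C)]
  congr 1
  refine Finset.sum_congr (Finset.filter_congr fun q hq => ?_) fun _ _ => rfl
  rw [mem_pairsA] at hq
  have := hq.2.2 0
  unfold qX at this
  omega

theorem Wsum_R {F : Type} [Field F] (n C : ℕ) (t : F) (G : (Fin (n+1) → ℕ) → F) :
    Wsum (n+1) (C+1) qR t G = Wsum (n+1) (C+1) (qX (C+1)) t G +
      Wsum n (C+1) qR t (fun ν => G (Fin.cons (C+1) ν)) := by
  have h1 := Wsum_low (C := C) (Q := qR) t G (fun a b h _ => trivial)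
  have h2 := Wsum_peel (C := C+1) (Q := qR) (Q' := qX (C+1)) t G C (by omega) (by omega)
    trivial (fun a b _ _ _ => by simp only [qX, qR, true_and]; constructor <;> intro h <;> omega)
  have h3 := Wsum_peel (C := C+1) (Q := qR) (Q' := qR) t G (C+1) (by omega) (by omega)
    trivial (fun a b _ _ _ => by simp only [qR, true_and, true_iff]; omega)
  rw [if_pos (Nat.lt_succ_self _)] at h2
  rw [if_neg (lt_irrefl _), one_mul] at h3
  rw [Wsum_X, show Wsum (n+1) C qR t G = _ from h1.symm, ← h2, ← h3, add_assoc]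
  conv_lhs => unfold Wsum
  rw [← Finset.sum_filter_add_sum_filter_not _ (fun q => q.1 0 ≤ C)]
  congr 1
  rw [← Finset.sum_filter_add_sum_filter_not _ (fun q => q.2 0 = C), Finset.filter_filter,
    Finset.filter_filter]
  congr 1
  · refine Finset.sum_congr (Finset.filter_congr fun q hq => ?_) fun _ _ => rfl
    rw [mem_pairsA] at hq
    have := hq.2.2 0
    omega
  · refine Finset.sum_congr (Finset.filter_congr fun q hq => ?_) fun _ _ => rfl
    rw [mem_pairsA] at hq
    have := hq.2.2 0
    omega

theorem Wsum_empty {F : Type} [Field F] (C : ℕ) (Q : ℕ → ℕ → Prop) (t : F)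
    (G : (Fin 0 → ℕ) → F) : Wsum 0 C Q t G = G (fun _ => 0) := by
  have : pairsA 0 C Q = {(fun _ => 0, fun _ => 0)} := by
    ext q
    rw [mem_pairsA, Finset.mem_singleton]
    exact ⟨fun _ => Subsingleton.elim _ _, fun _ =>
      ⟨fun i => i.elim0, fun i => i.elim0, fun i => i.elim0⟩⟩
  unfold Wsum
  rw [this, Finset.sum_singleton]
  simp [cells]

theorem Wsum_R_zero {F : Type} [Field F] (n : ℕ) (t : F)
    (G : (Fin n → ℕ) → F) : Wsum n 0 qR t G = G (fun _ => 0) := by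
  have : pairsA n 0 qR = {(fun _ => 0, fun _ => 0)} := by
    ext q
    rw [mem_pairsA, Finset.mem_singleton]
    constructor
    · rintro ⟨_, _, h⟩
      refine Prod.ext (funext fun i => ?_) (funext fun i => ?_)
      · have := h i; simp only; omega
      · have := h i; simp only; omega
    · rintro rfl
      exact ⟨fun _ _ _ => le_rfl, fun _ _ _ => le_rfl, fun i => ⟨le_rfl, le_rfl, by simp, trivial⟩⟩
  unfold Wsum
  rw [this, Finset.sum_singleton]
  simp [cells]

theorem Wsum_PP {F : Type} [Field F] (n C : ℕ) (Q : ℕ → ℕ → Prop) (t : F) (e : ℤ)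
    (x : Fin (n+1) → F) (g : Fin (n+1) → (Fin n → ℕ) → F) :
    Wsum n C Q t (fun ν => PP e x (fun j => g j ν)) = PP e x (fun j => Wsum n C Q t (g j)) := by
  unfold Wsum PP
  simp only [Finset.mul_sum]
  rw [Finset.sum_comm]
  refine Finset.sum_congr rfl fun j _ => Finset.sum_congr rfl fun q _ => ?_
  ring

theorem Wsum_cons {F : Type} [Field F] (n C : ℕ) (Q : ℕ → ℕ → Prop) (t : F) (a : ℕ)
    (x : Fin (n+1) → F) (hx : Function.Injective x) :
    Wsum n C Q t (fun ν => sg (Fin.cons a ν : Fin (n+1) → ℕ) x) =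
      PP (a : ℤ) x (fun j => Wsum n C Q t (fun ν => sg ν (fun i => x (j.succAbove i)))) := by
  rw [← Wsum_PP]
  unfold Wsum
  exact Finset.sum_congr rfl fun q _ => by simp only [sg_cons _ _ _ hx]

theorem sg_empty {F : Type} [Field F] (ν : Fin 0 → ℕ) (x : Fin 0 → F) : sg ν x = 1 := by
  simp [sg, al, pp]

theorem Rf_zero {F : Type} [Field F] {t : F} : ∀ (n : ℕ) (x : Fin n → F), Good t x →
    Rf 0 t x = 1 := by
  intro n
  induction n with
  | zero => intro x hx; exact (form_empty 0 hx.t1 x).2.2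
  | succ n ih =>
    intro x hx
    rw [Rf_rec _ _ _ hx, Xf_zero hx, zero_add, ← sg_zero x hx.inj]
    have : (fun _ => 0 : Fin (n+1) → ℕ) = Fin.cons 0 (fun _ => 0) := by
      funext i; refine Fin.cases ?_ (fun i => ?_) i <;> simp
    rw [this, sg_cons _ _ _ hx.inj]
    unfold PP
    refine Finset.sum_congr rfl fun j _ => ?_
    simp only [ih _ (hx.sa j), sg_zero _ (hx.sa j).inj, Nat.cast_zero]

theorem Wsum_step {F : Type} [Field F] {t : F} (C : ℕ)
    (hC : ∀ (n : ℕ) (x : Fin n → F), Good t x → Wsum n C qR t (fun ν => sg ν x) = Rf (C : ℤ) t x) :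
    ∀ (n : ℕ) (x : Fin n → F), Good t x →
      Wsum n (C+1) (qS (C+1)) t (fun ν => sg ν x) = Sf ((C+1 : ℕ) : ℤ) t x ∧
      Wsum n (C+1) (qX (C+1)) t (fun ν => sg ν x) = Xf ((C+1 : ℕ) : ℤ) t x ∧
      Wsum n (C+1) qR t (fun ν => sg ν x) = Rf ((C+1 : ℕ) : ℤ) t x := by
  intro n
  have hc : ((C+1 : ℕ) : ℤ) - 1 = (C : ℤ) := by push_cast; ring
  induction n with
  | zero =>
    intro x hx
    obtain ⟨h1, h2, h3⟩ := form_empty ((C+1 : ℕ) : ℤ) hx.t1 x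
    simp only [h1, h2, h3, Wsum_empty, sg_empty, and_self]
  | succ n ih =>
    intro x hx
    have hX : Wsum (n+1) (C+1) (qX (C+1)) t (fun ν => sg ν x) = Xf ((C+1 : ℕ) : ℤ) t x := by
      rw [Wsum_X, Wsum_cons _ _ _ _ _ _ hx.inj, hC _ _ hx, Xf_rec _ _ _ hx, hc]
      simp only [fun j => (ih _ (hx.sa j)).2.1]
    refine ⟨?_, hX, ?_⟩
    · rw [Wsum_S, Wsum_cons _ _ _ _ _ _ hx.inj, hC _ _ hx, Sf_rec _ _ _ hx, hc]
      simp only [fun j => (ih _ (hx.sa j)).1]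
    · rw [Wsum_R, Wsum_cons _ _ _ _ _ _ hx.inj, hX, Rf_rec _ _ _ hx]
      simp only [fun j => (ih _ (hx.sa j)).2.2]

theorem Wsum_qR {F : Type} [Field F] {t : F} (C : ℕ) :
    ∀ (n : ℕ) (x : Fin n → F), Good t x → Wsum n C qR t (fun ν => sg ν x) = Rf (C : ℤ) t x := by
  induction C with
  | zero =>
    intro n x hx
    rw [Wsum_R_zero, sg_zero _ hx.inj, Nat.cast_zero, Rf_zero n x hx]
  | succ C ih => exact fun n x hx => (Wsum_step C ih n x hx).2.2

theorem Wsum_qS {F : Type} [Field F] {t : F} (C : ℕ) (n : ℕ) (x : Fin n → F) (hx : Good t x) :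
    Wsum n (C+1) (qS (C+1)) t (fun ν => sg ν x) = Sf ((C+1 : ℕ) : ℤ) t x :=
  (Wsum_step C (Wsum_qR C) n x hx).1


/-! ### Comparing coefficients of `t` -/

theorem coeff_compare {F : Type} [Field F] {n : ℕ} {S : Set F} (hS : S.Infinite)
    (a b : Fin (n+1) → F)
    (h : ∀ t ∈ S, ∑ p : Fin (n+1), t ^ (p : ℕ) * a p = ∑ p : Fin (n+1), t ^ (p : ℕ) * b p) : a = b := by
  have key : ∀ c : Fin (n+1) → F, ∀ p : Fin (n+1),
      (∑ k, Polynomial.C (c k) * Polynomial.X ^ (k : ℕ)).coeff (p : ℕ) = c p := by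
    intro c p
    rw [Polynomial.finsetSum_coeff]
    simp only [Polynomial.coeff_C_mul_X_pow]
    rw [Finset.sum_eq_single p]
    · simp
    · intro k _ hk
      rw [if_neg]
      exact fun h => hk (Fin.ext h.symm)
    · simp
  have hp := Polynomial.eq_of_infinite_eval_eq
    (∑ k, Polynomial.C (a k) * Polynomial.X ^ (k : ℕ))
    (∑ k, Polynomial.C (b k) * Polynomial.X ^ (k : ℕ)) (hS.mono fun t ht => by
      have := h t ht
      simp only [Set.mem_ofPred_eq, Polynomial.eval_finsetSum, Polynomial.eval_mul,
        Polynomial.eval_C, Polynomial.eval_pow, Polynomial.eval_X]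
      simpa only [mul_comm] using this)
  funext p
  rw [← key a p, ← key b p, hp]

theorem Wsum_aCoeff {F : Type} [Field F] (n C : ℕ) (t : F) (G : (Fin n → ℕ) → F) :
    Wsum n C (qS C) t G = ∑ p : Fin (n+1), t ^ (p : ℕ) *
      ∑ ν ∈ ((Fintype.piFinset fun _ : Fin n => Finset.range (C + 1)).filter
          (fun ν => Antitone ν)), (aCoeff n C p ν : F) * G ν := by
  unfold Wsum pairsA
  simp only [Finset.mul_sum]
  rw [Finset.sum_comm, Finset.sum_filter, Finset.sum_filter, Finset.sum_product]
  refine Finset.sum_congr rfl fun ν _ => ?_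
  by_cases hν : Antitone ν
  · rw [if_pos hν]
    unfold aCoeff
    simp only [Finset.card_filter _ (Fintype.piFinset fun _ : Fin n => Finset.range (C + 1)),
      Nat.cast_sum, Finset.sum_mul, Finset.mul_sum]
    rw [Finset.sum_comm]
    refine Finset.sum_congr rfl fun ρ _ => ?_
    have hle : cells (ν, ρ) < n + 1 := by
      unfold cells
      have := Finset.card_filter_le (Finset.univ : Finset (Fin n)) (fun i => ρ i < ν i)
      rw [Finset.card_univ, Fintype.card_fin] at this
      exact Nat.lt_succ_of_le this
    rw [Finset.sum_eq_single (⟨cells (ν, ρ), hle⟩ : Fin (n+1))]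
    · have : (Antitone ν ∧ Antitone ρ ∧ ∀ i, ρ i ≤ ν i ∧ ν i ≤ ρ i + 1 ∧ qS C (ν i) (ρ i)) ↔
        (Antitone ρ ∧ (∀ i, ρ i ≤ ν i) ∧ (∀ i, ν i ≤ ρ i + 1) ∧
          (Finset.univ.filter (fun i : Fin n => ρ i < ν i)).card = cells (ν, ρ) ∧
          (∀ i, ρ i < ν i → ν i ≠ C)) := by
        constructor
        · rintro ⟨_, h2, h3⟩
          exact ⟨h2, fun i => (h3 i).1, fun i => (h3 i).2.1, rfl, fun i => (h3 i).2.2⟩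
        · rintro ⟨h2, h3, h4, _, h5⟩
          exact ⟨hν, h2, fun i => ⟨h3 i, h4 i, h5 i⟩⟩
      simp only [this]
      split_ifs <;> simp
    · intro p _ hp
      rw [if_neg]
      · simp
      · rintro ⟨_, _, _, h, _⟩
        exact hp (Fin.ext h.symm)
    · simp
  · rw [if_neg hν]
    apply Finset.sum_eq_zero
    intro ρ _
    rw [if_neg]
    exact fun h => hν h.1

theorem KV_Sf_rev {F : Type} [Field F] {n : ℕ} (C : ℤ) {t : F} {x : Fin n → F} (hx : Good t x) :
    KV x * Sf C t x = ∑ p : Fin (n+1), t ^ (p:ℕ) *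
      Dt (C + (2 * (n:ℤ) - 1)) x (fun i => (p.rev.succAbove i : ℕ)) := by
  rw [KV_Sf C hx, ← Equiv.sum_comp Fin.revPerm]
  refine Finset.sum_congr rfl fun p _ => ?_
  simp only [Fin.revPerm_apply]
  congr 2
  rw [Fin.val_rev]
  have := p.2
  omega

theorem main_id {F : Type} [Field F] {n : ℕ} (C : ℕ) {x : Fin n → F}
    (hx : {t : F | Good t x}.Infinite) (p : Fin (n+1)) :
    KV x * ∑ ν ∈ ((Fintype.piFinset fun _ : Fin n => Finset.range (C + 1 + 1)).filter
          (fun ν => Antitone ν)), (aCoeff n (C+1) p ν : F) * sg ν x =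
      Dt (((C+1 : ℕ) : ℤ) + (2 * (n:ℤ) - 1)) x (fun i => (p.rev.succAbove i : ℕ)) := by
  refine congrFun (coeff_compare hx (fun p : Fin (n+1) => KV x * ∑ ν ∈ ((Fintype.piFinset fun _ : Fin n =>
    Finset.range (C + 1 + 1)).filter (fun ν => Antitone ν)), (aCoeff n (C+1) p ν : F) * sg ν x)
    (fun p => Dt (((C+1 : ℕ) : ℤ) + (2 * (n:ℤ) - 1)) x (fun i => (p.rev.succAbove i : ℕ))) ?_) p
  intro t ht
  rw [← KV_Sf_rev _ ht, ← Wsum_qS C n x ht, Wsum_aCoeff, Finset.mul_sum]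
  exact Finset.sum_congr rfl fun p _ => by ring

theorem denom_id {F : Type} [Field F] {n : ℕ} {x : Fin (n+1) → F}
    (hx : {t : F | Good t x}.Infinite) :
    Dt (0 + (2 * ((n+1 : ℕ):ℤ) - 1)) x (fun i => (i : ℕ)) = KV x := by
  have h := coeff_compare hx
    (fun p => Dt (0 + (2 * ((n+1 : ℕ):ℤ) - 1)) x (fun i => (p.rev.succAbove i : ℕ)))
    (Fin.cons (KV x) (Fin.cons (-KV x) (fun _ => 0))) (by
      intro t ht
      have ht' : Good t x := ht
      rw [← KV_Sf_rev _ ht]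
      have h1 := Rf_eq 0 t x
      have h1t : (1 - t) ≠ 0 := sub_ne_zero.mpr (Ne.symm ht'.t1)
      rw [Rf_zero _ x ht, Xf_zero ht, eq_div_iff h1t] at h1
      rw [Fin.sum_univ_succ, Fin.sum_univ_succ]
      simp only [Fin.cons_zero, Fin.cons_succ, mul_zero, Finset.sum_const_zero, Fin.val_succ,
        Fin.val_zero]
      linear_combination - KV x * h1)
  have h0 := congrFun h 0
  simpa [Fin.rev_zero] using h0

theorem so_det {F : Type} [Field F] {n : ℕ} (N : ℤ) (y : Fin n → F) (hy : ∀ j, y j ≠ 0)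
    (κ : Fin n → ℕ) (M : Fin n → ℤ) (hM : ∀ i, M i = N - 2 * κ i) :
    Matrix.det (Matrix.of fun i j : Fin n => y j ^ (M i) - y j ^ (-(M i))) =
      (∏ j, y j ^ (-N)) * Dt N (fun j => y j ^ 2) κ := by
  unfold Dt
  rw [← Matrix.det_mul_row]
  congr 1
  ext i j
  simp only [Matrix.of_apply]
  rw [mul_sub, hM i]
  congr 1
  · rw [← zpow_natCast, ← zpow_mul, ← zpow_add₀ (hy j)]
    congr 1; push_cast; ring
  · rw [← pow_mul, ← zpow_natCast, ← zpow_add₀ (hy j)]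
    congr 1; push_cast; ring

theorem good_infinite {F : Type} [Field F] [Infinite F] {n : ℕ} {x : Fin n → F}
    (x0 : ∀ j, x j ≠ 0) (x1 : ∀ j, x j ≠ 1) (xm : ∀ j, x j ≠ -1)
    (inj : Function.Injective x) (mul : ∀ i j, i ≠ j → x i * x j ≠ 1) :
    {t : F | Good t x}.Infinite := by
  have hfin : (({0, 1} : Set F) ∪ (Set.range (fun j => - x j) ∪
    Set.range (fun j => - (x j)⁻¹))).Finite :=
    (Set.toFinite _).union ((Set.finite_range _).union (Set.finite_range _))
  refine hfin.infinite_compl.mono ?_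
  intro t ht
  simp only [Set.mem_compl_iff, Set.mem_union, Set.mem_insert_iff, Set.mem_singleton_iff,
    Set.mem_range, not_or, not_exists] at ht
  exact ⟨ht.1.1, ht.1.2, x0, x1, xm, inj, mul, fun j h => ht.2.1 j h.symm,
    fun j h => ht.2.2 j h.symm⟩

theorem FF_ne {n : ℕ} (P Q : MvPolynomial (Fin n) ℚ) (v : Fin n → ℚ)
    (h : MvPolynomial.eval v P ≠ MvPolynomial.eval v Q) :
    algebraMap (MvPolynomial (Fin n) ℚ) (FF n) P ≠ algebraMap _ (FF n) Q := fun h' =>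
  h (congrArg _ (IsFractionRing.injective (MvPolynomial (Fin n) ℚ) (FF n) h'))

theorem FF_good (n : ℕ) : {t : FF n | Good t (fun j => Xv n j ^ 2)}.Infinite := by
  haveI : Infinite (FF n) := Infinite.of_injective _
    (IsFractionRing.injective (MvPolynomial (Fin n) ℚ) (FF n))
  apply good_infinite
  · intro j
    have := FF_ne (MvPolynomial.X j ^ 2) 0 (fun _ => 1) (by simp)
    simpa [Xv] using this
  · intro j
    have := FF_ne (MvPolynomial.X j ^ 2) 1 (fun _ => 2) (by simp; norm_num)
    simpa only [Xv, map_pow, map_one] using this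
  · intro j
    have := FF_ne (MvPolynomial.X j ^ 2) (-1) (fun _ => 2) (by simp; norm_num)
    simpa only [Xv, map_pow, map_one, map_neg] using this
  · intro i j h
    by_contra hij
    have := FF_ne (MvPolynomial.X i ^ 2) (MvPolynomial.X j ^ 2) (fun k => if k = i then 1 else 2)
      (by simp [Ne.symm hij]; norm_num)
    simp only [map_pow] at this
    exact this h
  · intro i j _
    have := FF_ne (MvPolynomial.X i ^ 2 * MvPolynomial.X j ^ 2) 1 (fun _ => 2) (by simp; norm_num)
    simpa only [Xv, map_pow, map_one, map_mul] using this

theorem Xv_ne (n : ℕ) (j : Fin n) : Xv n j ≠ 0 := by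
  have := FF_ne (MvPolynomial.X j) 0 (fun _ => 1) (by simp)
  simpa [Xv] using this

theorem main_pos (N C p : ℕ) (hpn : p ≤ N + 1) :
    soOdd (N+1) (fun i : Fin (N+1) => if (i : ℕ) < (N+1) - p then ((C+1 : ℕ) : ℤ)
        else ((C+1 : ℕ) : ℤ) - 2) (Xv (N+1))
      = (∏ i : Fin (N+1), Xv (N+1) i) ^ (-((C+1 : ℕ) : ℤ)) *
        ∑ ν ∈ ((Fintype.piFinset fun _ : Fin (N+1) => Finset.range (C + 1 + 1)).filter
          (fun ν => Antitone ν)),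
          (aCoeff (N+1) (C+1) p ν : FF (N+1)) *
            schur (fun i => (ν i : ℤ)) (fun j => Xv (N+1) j ^ 2) := by
  have hg := FF_good (N+1)
  obtain ⟨t, ht⟩ := hg.nonempty
  have hK := KV_ne ht
  have hinj := ht.inj
  simp only [schur_eq_sg _ _ hinj]
  have hm := main_id C hg ⟨p, by omega⟩
  have hd := denom_id hg
  unfold soOdd
  rw [so_det (((C+1 : ℕ) : ℤ) + (2 * ((N+1 : ℕ):ℤ) - 1)) (Xv (N+1)) (Xv_ne _)
    (fun i => ((Fin.rev (⟨p, by omega⟩ : Fin (N+1+1))).succAbove i : ℕ))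
    (fun i : Fin (N+1) => (if (i : ℕ) < (N+1) - p then ((C+1 : ℕ) : ℤ)
        else ((C+1 : ℕ) : ℤ) - 2) + 2 * ((N+1 : ℕ) : ℤ) - 2 * ((i : ℕ) : ℤ) - 1),
    so_det (0 + (2 * ((N+1 : ℕ):ℤ) - 1)) (Xv (N+1)) (Xv_ne _) (fun i => (i : ℕ))
    (fun i : Fin (N+1) => 2 * ((N+1 : ℕ) : ℤ) - 2 * ((i : ℕ) : ℤ) - 1), hd, ← hm]
  · have hz : ∀ e : ℤ, (∏ j, Xv (N+1) j ^ e) = (∏ j, Xv (N+1) j) ^ e := fun e =>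
      Finset.prod_zpow _ _ _
    have hne : (∏ j, Xv (N+1) j) ≠ 0 := Finset.prod_ne_zero_iff.mpr fun j _ => Xv_ne _ j
    rw [hz, hz, show -(((C+1 : ℕ) : ℤ) + (2 * ((N+1 : ℕ):ℤ) - 1)) =
      -((C+1 : ℕ) : ℤ) + -(0 + (2 * ((N+1 : ℕ):ℤ) - 1)) by ring, zpow_add₀ hne]
    have hq : (∏ j, Xv (N+1) j) ^ (-(0 + (2 * ((N+1 : ℕ):ℤ) - 1))) ≠ 0 := zpow_ne_zero _ hne
    rw [div_eq_iff (mul_ne_zero hq hK)]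
    ring
  · intro i
    ring
  · intro i
    simp only [Fin.succAbove, Fin.lt_def, Fin.val_castSucc, Fin.val_rev]
    have e : N + 1 + 1 - (p + 1) = N + 1 - p := by omega
    rw [e]
    split_ifs
    · simp; ring
    · simp; ring

theorem main_zero (N : ℕ) :
    soOdd (N+1) (fun i : Fin (N+1) => if (i : ℕ) < (N+1) - 0 then ((0 : ℕ) : ℤ)
        else ((0 : ℕ) : ℤ) - 2) (Xv (N+1))
      = (∏ i : Fin (N+1), Xv (N+1) i) ^ (-((0 : ℕ) : ℤ)) *
        ∑ ν ∈ ((Fintype.piFinset fun _ : Fin (N+1) => Finset.range (0 + 1)).filter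
          (fun ν => Antitone ν)),
          (aCoeff (N+1) 0 0 ν : FF (N+1)) *
            schur (fun i => (ν i : ℤ)) (fun j => Xv (N+1) j ^ 2) := by
  have hg := FF_good (N+1)
  obtain ⟨t, ht⟩ := hg.nonempty
  have hK := KV_ne ht
  have hd := denom_id hg
  have hne : (∏ j, Xv (N+1) j ^ (-(0 + (2 * ((N+1 : ℕ):ℤ) - 1)))) ≠ 0 :=
    Finset.prod_ne_zero_iff.mpr fun j _ => zpow_ne_zero _ (Xv_ne _ j)
  have hset : ((Fintype.piFinset fun _ : Fin (N+1) => Finset.range (0 + 1)).filter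
          (fun ν => Antitone ν)) = {fun _ => 0} := by
    ext ν
    simp only [Finset.mem_filter, Fintype.mem_piFinset, Finset.mem_range, Finset.mem_singleton]
    constructor
    · rintro ⟨h, _⟩
      funext i
      have := h i
      omega
    · rintro rfl
      exact ⟨fun _ => by simp, fun _ _ _ => le_rfl⟩
  have ha : aCoeff (N+1) 0 0 (fun _ => 0) = 1 := by
    unfold aCoeff
    rw [Finset.card_eq_one]
    refine ⟨fun _ => 0, ?_⟩
    ext ρ
    simp only [Finset.mem_filter, Fintype.mem_piFinset, Finset.mem_range, Finset.mem_singleton]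
    constructor
    · rintro ⟨h, _⟩
      funext i
      have := h i
      omega
    · rintro rfl
      exact ⟨fun _ => by simp, fun _ _ _ => le_rfl, by simp, by simp, by simp, by simp⟩
  rw [hset, Finset.sum_singleton, ha, schur_zero]
  unfold soOdd
  have hI : ∀ i : Fin (N+1), (if (i : ℕ) < (N+1) - 0 then ((0 : ℕ) : ℤ)
        else ((0 : ℕ) : ℤ) - 2) + 2 * ((N+1 : ℕ) : ℤ) - 2 * ((i : ℕ) : ℤ) - 1 =
        2 * ((N+1 : ℕ) : ℤ) - 2 * ((i : ℕ) : ℤ) - 1 := by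
    intro i
    rw [if_pos (by have := i.2; omega)]
    simp
  simp only [hI]
  rw [so_det (0 + (2 * ((N+1 : ℕ):ℤ) - 1)) (Xv (N+1)) (Xv_ne _) (fun i => (i : ℕ))
    (fun i : Fin (N+1) => 2 * ((N+1 : ℕ) : ℤ) - 2 * ((i : ℕ) : ℤ) - 1), hd,
    div_self (mul_ne_zero hne hK)]
  · simp
  · intro i
    ring




/-- `so_{2n+1}((c^{n-p},(c-1)^p); x^{±1}) = (x_1⋯x_n)^{-c} ·
∑_{ν ⊆ ((2c)^n)} a_{n,p}(ν) s_n(ν; x)`; stated in the variables `y` with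
`x_j = y_j²`, where `C = 2c`. -/
theorem soOdd_nearly_rectangular_rows_eq_sum_schur
    (n C p : ℕ) (hn : 1 ≤ n) (hpn : p ≤ n) (hc : 1 ≤ p → 2 ≤ C) :
    soOdd n (fun i : Fin n => if (i : ℕ) < n - p then (C : ℤ) else (C : ℤ) - 2) (Xv n)
      = (∏ i : Fin n, Xv n i) ^ (-(C : ℤ)) *
        ∑ ν ∈ ((Fintype.piFinset fun _ : Fin n => Finset.range (C + 1)).filter
          (fun ν => Antitone ν)),
          (aCoeff n C p ν : FF n) * schur (fun i => (ν i : ℤ)) (fun j => Xv n j ^ 2) := by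
  obtain ⟨N, rfl⟩ : ∃ N, n = N + 1 := ⟨n - 1, by omega⟩
  cases C with
  | zero =>
    obtain rfl : p = 0 := by
      by_contra h
      have := hc (by omega)
      omega
    exact main_zero N
  | succ C => exact main_pos N C p hpn

end
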